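/- Let H = kQ be a hereditary algebra with underlying graph E_6, E_7, or E_8. Then the nilpotency index of the radical of mod H equals 11, 17, or 29 respectively. -/

import Mathlib

open CategoryTheory
open scoped Classical

/-! ## Quiver combinatorics -/

/-- Paths in a quiver given by source and target maps. -/
inductive QPath {V E : Type} (src tgt : E → V) : V → V → Type
  | nil (a : V) : QPath src tgt a a
  | cons {a b : V} (p : QPath src tgt a b) (α : E) (h : src α = b) : QPath src tgt a (tgt α)

namespace QPath

variable {V E : Type} {src tgt : E → V}

def length : ∀ {a b : V}, QPath src tgt a b → ℕ
  | _, _, .nil _ => 0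
  | _, _, .cons p _ _ => p.length + 1

def comp : ∀ {a b c : V}, QPath src tgt a b → QPath src tgt b c → QPath src tgt a c
  | _, _, _, p, .nil _ => p
  | _, _, _, p, .cons q α h => .cons (p.comp q) α h

/-- The list of vertices visited by a path, in order. -/
def verts : ∀ {a b : V}, QPath src tgt a b → List V
  | a, _, .nil _ => [a]
  | _, _, .cons p α _ => p.verts ++ [tgt α]

/-- The interior (intermediate) vertices of a path. -/
def interior {a b : V} (p : QPath src tgt a b) : List V :=
  (p.verts.dropLast).drop 1

/-- The list of arrows of a path, in walk order. -/
def arrows : ∀ {a b : V}, QPath src tgt a b → List E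
  | _, _, .nil _ => []
  | _, _, .cons p α _ => p.arrows ++ [α]

end QPath

/-- A presentation of the algebra `A` by the (ordinary) quiver with vertex set `V`
and arrow set `E` : a complete family of orthogonal primitive idempotents indexed by
the vertices together with generators indexed by the arrows. -/
structure QuiverPresentation (k A V E : Type) [Field k] [Ring A] [Algebra k A]
    [Fintype V] [Fintype E] where
  src : E → V
  tgt : E → V
  idem : V → A
  arrow : E → A
  idem_idem : ∀ a : V, idem a * idem a = idem a
  idem_orth : ∀ a b : V, a ≠ b → idem a * idem b = 0
  sum_idem : ∑ a : V, idem a = 1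
  idem_ne : ∀ a : V, idem a ≠ 0
  idem_primitive : ∀ (v : V) (f g : A), f * f = f → g * g = g → f * g = 0 → g * f = 0 →
    f + g = idem v → f = 0 ∨ g = 0
  arrow_mem : ∀ α : E, idem (tgt α) * arrow α * idem (src α) = arrow α
  arrow_ne : ∀ α : E, arrow α ≠ 0
  generates : Algebra.adjoin k (Set.range idem ∪ Set.range arrow) = ⊤

namespace QuiverPresentation

variable {k A V E : Type} [Field k] [Ring A] [Algebra k A] [Fintype V] [Fintype E]

/-- The product in `A` of the arrows along a path (paths are written right to left). -/
def qprod (P : QuiverPresentation k A V E) :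
    ∀ {a b : V}, QPath P.src P.tgt a b → A
  | _, _, .nil a => P.idem a
  | _, _, .cons p α _ => P.arrow α * P.qprod p

/-- The ideal of relations is admissible: all sufficiently long paths vanish. -/
def Admissible (P : QuiverPresentation k A V E) : Prop :=
  ∃ N : ℕ, ∀ (a b : V) (p : QPath P.src P.tgt a b), N ≤ p.length → P.qprod p = 0

/-- The presentation is minimal: the idempotents and the arrows are linearly
independent modulo the span of the products of paths of length at least two,
so that `(V, E)` really is the ordinary quiver of `A`. -/
def Minimal (P : QuiverPresentation k A V E) : Prop :=
  ∀ (c : V → k) (d : E → k),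
    ((∑ a : V, c a • P.idem a) + ∑ α : E, d α • P.arrow α) ∈
      Submodule.span k {x : A | ∃ (a b : V) (p : QPath P.src P.tgt a b),
        2 ≤ p.length ∧ P.qprod p = x} →
    (∀ a, c a = 0) ∧ (∀ α, d α = 0)

/-- The algebra is monomial: the ideal of relations is generated by paths; equivalently,
the images of the paths which do not vanish are linearly independent. -/
def Monomial (P : QuiverPresentation k A V E) : Prop :=
  LinearIndependent k
    (fun q : {q : Σ a : V, Σ b : V, QPath P.src P.tgt a b // P.qprod q.2.2 ≠ 0} =>
      P.qprod q.1.2.2)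

/-- A (minimal) zero-relation: a path of length at least two whose product vanishes
while the product along every proper subpath does not. -/
def IsZeroRel (P : QuiverPresentation k A V E) {a b : V} (p : QPath P.src P.tgt a b) : Prop :=
  P.qprod p = 0 ∧ 2 ≤ p.length ∧
  ∀ (x y : V) (q : QPath P.src P.tgt x y) (p₁ : QPath P.src P.tgt a x)
    (p₂ : QPath P.src P.tgt y b),
      p = p₁.comp (q.comp p₂) → q.length < p.length → P.qprod q ≠ 0

/-- A vertex `u` is involved in a zero-relation `α_m ⋯ α_1` if `u = s(α_i)`
for some `i = 2, …, m`, i.e. `u` is an interior vertex of the relation. -/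
def InvolvedInZeroRel (P : QuiverPresentation k A V E) (u : V) : Prop :=
  ∃ (a b : V) (p : QPath P.src P.tgt a b), P.IsZeroRel p ∧ u ∈ p.interior

/-! ### Walks (for strings and for connectivity) -/

/-- The starting vertex of a step (an arrow traversed forwards or backwards). -/
def stepSrc (P : QuiverPresentation k A V E) (s : E × Bool) : V :=
  if s.2 then P.src s.1 else P.tgt s.1

/-- The ending vertex of a step. -/
def stepTgt (P : QuiverPresentation k A V E) (s : E × Bool) : V :=
  if s.2 then P.tgt s.1 else P.src s.1

/-- `l` is a walk from `a` to `b` in the underlying graph of the quiver. -/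
def IsWalkFrom (P : QuiverPresentation k A V E) : V → List (E × Bool) → V → Prop
  | a, [], b => a = b
  | a, s :: l, b => P.stepSrc s = a ∧ P.IsWalkFrom (P.stepTgt s) l b

/-- The product in `A` of a list of arrows (listed in walk order). -/
def wprod (P : QuiverPresentation k A V E) (l : List E) : A :=
  ((l.map P.arrow).reverse).prod

/-- A reduced walk: no step is immediately followed by its inverse. -/
def Reduced (l : List (E × Bool)) : Prop :=
  ¬ ∃ (l₁ : List (E × Bool)) (s : E × Bool) (l₂ : List (E × Bool)),
      l = l₁ ++ s :: (s.1, !s.2) :: l₂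

/-- No direct subwalk of `l` nor the inverse of such lies in the ideal of relations. -/
def NoZeroSub (P : QuiverPresentation k A V E) (l : List (E × Bool)) : Prop :=
  ∀ (l₁ : List (E × Bool)) (r : List E) (l₂ : List (E × Bool)),
    (l = l₁ ++ (r.map (fun e => (e, true))) ++ l₂ → P.wprod r ≠ 0) ∧
    (l = l₁ ++ (r.map (fun e => (e, false))) ++ l₂ → P.wprod r.reverse ≠ 0)

/-- A string from `a` to `b`. -/
def IsStringWalk (P : QuiverPresentation k A V E) (a : V) (l : List (E × Bool)) (b : V) : Prop :=
  P.IsWalkFrom a l b ∧ Reduced l ∧ P.NoZeroSub l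

/-- `(Q_u^s)_0` : the strings starting at `u` that are trivial or start with an arrow. -/
def QSset (P : QuiverPresentation k A V E) (u : V) : Set (List (E × Bool)) :=
  {l | ∃ b : V, P.IsStringWalk u l b ∧ (l = [] ∨ ∃ (α : E) (l' : List (E × Bool)),
    l = (α, true) :: l')}

/-- `(Q_u^e)_0` : the strings ending at `u` that are trivial or end with an arrow. -/
def QEset (P : QuiverPresentation k A V E) (u : V) : Set (List (E × Bool)) :=
  {l | ∃ a : V, P.IsStringWalk a l u ∧ (l = [] ∨ ∃ (α : E) (l' : List (E × Bool)),
    l = l' ++ [(α, true)])}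

/-- `S_γ` : the strings starting with the arrow `γ`. -/
def Sarr (P : QuiverPresentation k A V E) (γ : E) : Set (List (E × Bool)) :=
  {l | ∃ b : V, P.IsStringWalk (P.src γ) l b ∧ ∃ l' : List (E × Bool), l = (γ, true) :: l'}

/-- `E_γ` : the strings ending with the arrow `γ`. -/
def Earr (P : QuiverPresentation k A V E) (γ : E) : Set (List (E × Bool)) :=
  {l | ∃ a : V, P.IsStringWalk a l (P.tgt γ) ∧ ∃ l' : List (E × Bool), l = l' ++ [(γ, true)]}

/-- The defining conditions of a string algebra. -/
def IsStringAlgebra (P : QuiverPresentation k A V E) : Prop :=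
  P.Monomial ∧
  (∀ v : V, Nat.card {α : E // P.src α = v} ≤ 2) ∧
  (∀ v : V, Nat.card {α : E // P.tgt α = v} ≤ 2) ∧
  (∀ γ : E, Nat.card {β : E // P.src β = P.tgt γ ∧ P.arrow β * P.arrow γ ≠ 0} ≤ 1) ∧
  (∀ β : E, Nat.card {γ : E // P.src β = P.tgt γ ∧ P.arrow β * P.arrow γ ≠ 0} ≤ 1)

/-- Connectivity in the underlying graph, avoiding a given set of arrows. -/
def ConnAvoid (P : QuiverPresentation k A V E) (avoid : Set E) (a b : V) : Prop :=
  ∃ l : List (E × Bool), P.IsWalkFrom a l b ∧ ∀ s ∈ l, s.1 ∉ avoid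

def Connected (P : QuiverPresentation k A V E) : Prop := ∀ a b : V, P.ConnAvoid ∅ a b

/-- The underlying graph of the quiver is a tree. -/
def IsTreeQuiver (P : QuiverPresentation k A V E) : Prop :=
  P.Connected ∧ Fintype.card E + 1 = Fintype.card V

/-- The underlying (undirected) graph of the quiver is given by the edge-endpoint
specification `ends` on `nV` vertices and `nE` edges. -/
def GraphSpec (P : QuiverPresentation k A V E) (nV nE : ℕ) (ends : Fin nE → ℕ × ℕ) : Prop :=
  ∃ (v : Fin nV ≃ V) (ar : Fin nE ≃ E), ∀ i : Fin nE, ∃ a b : Fin nV,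
    (a : ℕ) = (ends i).1 ∧ (b : ℕ) = (ends i).2 ∧
    ((P.src (ar i) = v a ∧ P.tgt (ar i) = v b) ∨ (P.src (ar i) = v b ∧ P.tgt (ar i) = v a))

/-- The directed quiver is given by the arrow specification `ends`. -/
def DirGraphSpec (P : QuiverPresentation k A V E) (nV nE : ℕ) (ends : Fin nE → ℕ × ℕ) : Prop :=
  ∃ (v : Fin nV ≃ V) (ar : Fin nE ≃ E), ∀ i : Fin nE, ∃ a b : Fin nV,
    (a : ℕ) = (ends i).1 ∧ (b : ℕ) = (ends i).2 ∧
    P.src (ar i) = v a ∧ P.tgt (ar i) = v b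

/-- The underlying graph of the full subquiver on vertices `S` and arrows `T`. -/
def SubGraphSpec (P : QuiverPresentation k A V E) (S : Set V) (T : Set E)
    (nV nE : ℕ) (ends : Fin nE → ℕ × ℕ) : Prop :=
  ∃ (v : Fin nV ≃ S) (ar : Fin nE ≃ T), ∀ i : Fin nE, ∃ a b : Fin nV,
    (a : ℕ) = (ends i).1 ∧ (b : ℕ) = (ends i).2 ∧
    ((P.src (ar i) = v a ∧ P.tgt (ar i) = v b) ∨ (P.src (ar i) = v b ∧ P.tgt (ar i) = v a))

end QuiverPresentation

/-- Edge endpoints of the Dynkin graph `A_n`. -/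
def typeAEnds (n : ℕ) : Fin (n - 1) → ℕ × ℕ := fun i => ((i : ℕ), (i : ℕ) + 1)

/-- Edge endpoints of the Dynkin graph `D_n`. -/
def typeDEnds (n : ℕ) : Fin (n - 1) → ℕ × ℕ := fun i =>
  if (i : ℕ) = 0 then (0, 2) else if (i : ℕ) = 1 then (1, 2) else ((i : ℕ), (i : ℕ) + 1)

/-- Edge endpoints of the Dynkin graph `E_m` for `m = 6, 7, 8`. -/
def typeEEnds (m : ℕ) : Fin (m - 1) → ℕ × ℕ := fun i =>
  if (i : ℕ) = m - 2 then (2, m - 1) else ((i : ℕ), (i : ℕ) + 1)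

/-! ## The module category, its radical and the nilpotency index -/

section ModuleSide

variable (A : Type) [Ring A]

/-- An indecomposable module: non-zero, with no non-trivial idempotent endomorphism. -/
def Indec (M : ModuleCat.{0} A) : Prop :=
  Nontrivial M ∧ ∀ f : M ⟶ M, f ≫ f = f → f = 0 ∨ f = 𝟙 M

/-- A finitely generated indecomposable module. -/
def FinIndec (M : ModuleCat.{0} A) : Prop := Module.Finite A M ∧ Indec A M

/-- `A` is representation-finite: finitely many finitely generated indecomposables
up to isomorphism. -/
def RepFinite : Prop :=
  ∃ (n : ℕ) (T : Fin n → ModuleCat.{0} A),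
    ∀ M : ModuleCat.{0} A, FinIndec A M → ∃ i, Nonempty (M ≅ T i)

/-- `A` is (left) hereditary. -/
def Hereditary : Prop := ∀ I : Submodule A A, Module.Projective A I

/-- An irreducible morphism: it does not split, and in any factorization one of
the factors splits. -/
def IrredMor {X Y : ModuleCat.{0} A} (f : X ⟶ Y) : Prop :=
  (¬ ∃ g : Y ⟶ X, f ≫ g = 𝟙 X) ∧ (¬ ∃ g : Y ⟶ X, g ≫ f = 𝟙 Y) ∧
  ∀ (Z : ModuleCat.{0} A), Module.Finite A Z → ∀ (u : X ⟶ Z) (v : Z ⟶ Y), f = u ≫ v →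
    (∃ r : Z ⟶ X, u ≫ r = 𝟙 X) ∨ (∃ s : Y ⟶ Z, s ≫ v = 𝟙 Y)

/-- The radical of `Hom(X, Y)`. -/
def radSet (X Y : ModuleCat.{0} A) : Set (X ⟶ Y) :=
  {f | ∀ M : ModuleCat.{0} A, FinIndec A M →
    ∀ (h : M ⟶ X) (h' : Y ⟶ M), ¬ IsIso (h ≫ f ≫ h')}

/-- Compositions of `n` radical morphisms. -/
def radPowSet : ℕ → ∀ (X Y : ModuleCat.{0} A), Set (X ⟶ Y)
  | 0, _, _ => Set.univ
  | n + 1, X, Y => {f | ∃ (M : ModuleCat.{0} A) (g : X ⟶ M) (h : M ⟶ Y),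
      Module.Finite A M ∧ g ∈ radSet A X M ∧ h ∈ radPowSet n M Y ∧ f = g ≫ h}

/-- The `n`-th power of the radical of `mod A` vanishes. -/
def RadVanishes (n : ℕ) : Prop :=
  ∀ X Y : ModuleCat.{0} A, Module.Finite A X → Module.Finite A Y →
    ∀ f ∈ radPowSet A n X Y, f = 0

/-- `m` is the nilpotency index of the radical of `mod A`. -/
def NilpotencyIndex (m : ℕ) : Prop :=
  1 ≤ m ∧ RadVanishes A m ∧ ∀ l : ℕ, RadVanishes A l → m ≤ l

/-- A path of irreducible morphisms between (f.g.) indecomposable modules,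
together with its composite morphism and its length. -/
inductive IrrPath : ∀ (M N : ModuleCat.{0} A), (M ⟶ N) → ℕ → Prop
  | nil (M : ModuleCat.{0} A) : FinIndec A M → IrrPath M M (𝟙 M) 0
  | cons {M X N : ModuleCat.{0} A} (f : M ⟶ X) (g : X ⟶ N) (n : ℕ) :
      FinIndec A M → IrredMor A f → IrrPath X N g n → IrrPath M N (f ≫ g) (n + 1)

/-- The Auslander–Reiten quiver of `A` is a component with length : parallel paths
of irreducible morphisms have the same length. -/
def WithLength : Prop :=
  ∀ (M N : ModuleCat.{0} A) (n m : ℕ),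
    (∃ f : M ⟶ N, IrrPath A M N f n) → (∃ g : M ⟶ N, IrrPath A M N g m) → n = m

/-- `N` is a successor of `M` (a path of non-zero morphisms between f.g.
indecomposables from `M` to `N`). -/
inductive Reach : ModuleCat.{0} A → ModuleCat.{0} A → Prop
  | refl (M : ModuleCat.{0} A) : FinIndec A M → Reach M M
  | cons {M X N : ModuleCat.{0} A} : FinIndec A M → FinIndec A X →
      (∃ f : M ⟶ X, f ≠ 0) → Reach X N → Reach M N

/-- `N` is a direct summand of `M`. -/
def IsSummand (N M : ModuleCat.{0} A) : Prop :=
  ∃ (i : N ⟶ M) (p : M ⟶ N), i ≫ p = 𝟙 N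

/-- The radical of a module (intersection of the maximal submodules). -/
def radOf (M : ModuleCat.{0} A) : Submodule A M := sInf {N | IsCoatom N}

/-- The socle of a module (sum of the simple submodules). -/
def socOf (M : ModuleCat.{0} A) : Submodule A M := sSup {N | IsAtom N}

/-- `0 → X → E → Y → 0` is an almost split (Auslander–Reiten) sequence. -/
def IsAlmostSplit {X E Y : ModuleCat.{0} A} (f : X ⟶ E) (g : E ⟶ Y) : Prop :=
  FinIndec A X ∧ FinIndec A Y ∧ Module.Finite A E ∧
  Function.Injective f ∧ Function.Surjective g ∧
  (∀ x : X, g (f x) = 0) ∧ (∀ e : E, g e = 0 → ∃ x : X, f x = e) ∧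
  (¬ ∃ s : Y ⟶ E, s ≫ g = 𝟙 Y) ∧
  (∀ (M : ModuleCat.{0} A) (h : X ⟶ M), (¬ ∃ r : M ⟶ X, h ≫ r = 𝟙 X) →
    ∃ t : E ⟶ M, f ≫ t = h) ∧
  (∀ (M : ModuleCat.{0} A) (h : M ⟶ Y), (¬ ∃ s : Y ⟶ M, s ≫ h = 𝟙 Y) →
    ∃ t : M ⟶ E, t ≫ g = h)

/-- `X = τ Y` : there is an almost split sequence `0 → X → E → Y → 0`. -/
def IsTauOf (X Y : ModuleCat.{0} A) : Prop :=
  ∃ (E : ModuleCat.{0} A) (f : X ⟶ E) (g : E ⟶ Y), IsAlmostSplit A f g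

/-- A sectional path of irreducible morphisms of length `n` from `M` to `N`. -/
def SectionalPath (M N : ModuleCat.{0} A) (n : ℕ) : Prop :=
  ∃ Y : Fin (n + 1) → ModuleCat.{0} A,
    Y 0 = M ∧ Y (Fin.last n) = N ∧ (∀ i, FinIndec A (Y i)) ∧
    (∀ i : Fin n, ∃ f : Y i.castSucc ⟶ Y i.succ, IrredMor A f) ∧
    ∀ (i : ℕ) (h : i + 2 ≤ n),
      ¬ IsTauOf A (Y ⟨i, by omega⟩) (Y ⟨i + 2, by omega⟩)

end ModuleSide

/-! ## Modules attached to vertices -/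

section Vertices

variable {k A V E : Type} [Field k] [Ring A] [Algebra k A] [Fintype V] [Fintype E]

/-- `S` is the simple module at the vertex `a`. -/
def IsSimpleAt (P : QuiverPresentation k A V E) (a : V) (S : ModuleCat.{0} A) : Prop :=
  IsSimpleModule A S ∧ ∃ x : S, P.idem a • x ≠ 0

/-- `Pm` is the indecomposable projective at the vertex `a`. -/
def IsProjAt (P : QuiverPresentation k A V E) (a : V) (Pm : ModuleCat.{0} A) : Prop :=
  Module.Projective A Pm ∧ FinIndec A Pm ∧
  ∃ (S : ModuleCat.{0} A) (f : Pm ⟶ S), IsSimpleAt P a S ∧ Function.Surjective f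

/-- `Im` is the indecomposable injective at the vertex `a`. -/
def IsInjAt (P : QuiverPresentation k A V E) (a : V) (Im : ModuleCat.{0} A) : Prop :=
  Module.Injective A Im ∧ FinIndec A Im ∧
  ∃ (S : ModuleCat.{0} A) (f : S ⟶ Im), IsSimpleAt P a S ∧ Function.Injective f

/-- `RVal P a n` : `n` is the length of a non-zero path of irreducible morphisms
between indecomposable modules from `P_a` to `I_a` going through `S_a`. -/
def RVal (P : QuiverPresentation k A V E) (a : V) (n : ℕ) : Prop :=
  ∃ (Pm S Im : ModuleCat.{0} A) (f : Pm ⟶ S) (g : S ⟶ Im) (n₁ n₂ : ℕ),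
    IsProjAt P a Pm ∧ IsSimpleAt P a S ∧ IsInjAt P a Im ∧
    IrrPath A Pm S f n₁ ∧ IrrPath A S Im g n₂ ∧ f ≫ g ≠ 0 ∧ n = n₁ + n₂

end Vertices


namespace DynkinRep

/-- The sum of the values of `d` over the neighbours of `v`. -/
noncomputable def nbSum {ι : Type} [Fintype ι] (adj : ι → ι → Prop) (d : ι → ℤ) (v : ι) : ℤ :=
  ∑ u : {u // adj v u}, d u

/-- The solution of `y (n + 2) + y n = (adjacency matrix) * y (n + 1)` with given initial values. -/
noncomputable def addSeq {ι : Type} [Fintype ι] (adj : ι → ι → Prop) (a b : ι → ℤ) : ℕ → ι → ℤ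
  | 0 => a
  | 1 => b
  | n + 2 => fun v => nbSum adj (addSeq adj a b (n + 1)) v - addSeq adj a b n v

/-- The vector with the value `1` at `i` and `0` elsewhere. -/
noncomputable def delta {ι : Type} (i : ι) : ι → ℤ := fun v => if v = i then 1 else 0

/-- A height function: adjacent vertices have heights which differ by one. -/
def IsSlice {ι : Type} (adj : ι → ι → Prop) (σ : ι → ℤ) : Prop :=
  ∀ u v, adj u v → σ u = σ v + 1 ∨ σ v = σ u + 1

/-- The numerical properties of a Dynkin graph with Coxeter number `h` and involution `star`. -/
structure CoxeterData {ι : Type} [Fintype ι] (adj : ι → ι → Prop) (h : ℕ) (star : ι → ι) :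
    Prop where
  symm : ∀ u v, adj u v → adj v u
  two_le : 2 ≤ h
  even : h % 2 = 0
  spread : ∀ σ, IsSlice adj σ → ∀ u v, σ u + 3 ≤ σ v + h
  parity : ∀ σ, IsSlice adj σ → ∀ u, σ (star u) % 2 = σ u % 2
  star_star : ∀ u, star (star u) = u
  nonneg : ∀ i v n, n ≤ h → 0 ≤ addSeq adj 0 (delta i) n v
  last : ∀ i, addSeq adj 0 (delta i) (h - 1) = delta (star i)
  zero : ∀ i, addSeq adj 0 (delta i) h = 0

/-- The vertices of the graph `E_m`, joined by the edges prescribed by their end points. -/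
def eAdj (m : ℕ) (u v : Fin m) : Prop :=
  (v : ℕ) + 1 < m ∧ (u : ℕ) + 1 = v ∨ (u : ℕ) + 1 < m ∧ (v : ℕ) + 1 = u ∨
    (u : ℕ) = 2 ∧ (v : ℕ) + 1 = m ∨ (v : ℕ) = 2 ∧ (u : ℕ) + 1 = m

section Numerics

variable {ι : Type} [Fintype ι] (adj : ι → ι → Prop)

theorem nbSum_eq (d : ι → ℤ) (v : ι) : nbSum adj d v = ∑ u, if adj v u then d u else 0 := by
  rw [nbSum, ← Finset.sum_filter, ← Finset.sum_subtype_eq_sum_filter]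
  simp

theorem addSeq_eq_sum (a b : ι → ℤ) (n : ℕ) (v : ι) :
    addSeq adj a b (n + 1) v = ∑ j, (b j * addSeq adj 0 (delta j) (n + 1) v -
      a j * addSeq adj 0 (delta j) n v) := by
  induction n using Nat.strong_induction_on generalizing v with
  | _ n ih =>
    have hd : ∀ (d : ι → ℤ) u, d u = ∑ j, d j * delta j u := fun d u => by simp [delta]
    match n with
    | 0 => simpa [addSeq] using hd b v
    | 1 =>
      have h1 : ∑ j, b j * nbSum adj (delta j) v = nbSum adj b v := by
        simp only [nbSum, Finset.mul_sum]
        rw [Finset.sum_comm]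
        exact Finset.sum_congr rfl fun u _ => (hd b u).symm
      show nbSum adj b v - a v = _
      rw [← h1, hd a v, ← Finset.sum_sub_distrib]
      simp [addSeq]
    | n + 2 =>
      show nbSum adj (addSeq adj a b (n + 1 + 1)) v - addSeq adj a b (n + 1) v = _
      rw [ih n (by omega), nbSum,
        Finset.sum_congr rfl (fun (u : {u // adj v u}) _ => ih (n + 1) (by omega) (u : ι)),
        Finset.sum_comm, ← Finset.sum_sub_distrib]
      refine Finset.sum_congr rfl fun j _ => ?_
      rw [show addSeq adj 0 (delta j) (n + 2 + 1) v =
          nbSum adj (addSeq adj 0 (delta j) (n + 1 + 1)) v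
            - addSeq adj 0 (delta j) (n + 1) v from rfl,
        show addSeq adj 0 (delta j) (n + 2) v =
          nbSum adj (addSeq adj 0 (delta j) (n + 1)) v
            - addSeq adj 0 (delta j) n v from rfl,
        nbSum, nbSum, Finset.sum_sub_distrib, ← Finset.mul_sum, ← Finset.mul_sum]
      ring

theorem CoxeterData.period {adj : ι → ι → Prop} {h : ℕ} {star : ι → ι}
    (D : CoxeterData adj h star) (a b : ι → ℤ) (v : ι) :
    addSeq adj a b h v = - a (star v) := by
  obtain ⟨g, rfl⟩ : ∃ g, h = g + 1 := ⟨h - 1, by have := D.two_le; omega⟩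
  have hl := D.last
  have hz := D.zero
  simp only [Nat.add_sub_cancel] at hl
  rw [addSeq_eq_sum]
  simp only [hl, hz, Pi.zero_apply, mul_zero, zero_sub, delta, mul_ite, mul_one,
    Finset.sum_neg_distrib, neg_inj]
  rw [Finset.sum_eq_single (star v)]
  · simp [D.star_star]
  · intro b _ hb
    rw [if_neg]
    rintro rfl
    exact hb (D.star_star b).symm
  · simp

/-- The neighbour sum of `E_m` on lists of natural numbers. -/
def nbList (m : ℕ) (l : List ℕ) (v : ℕ) : ℕ :=
  (if 1 ≤ v ∧ v + 1 < m then l.getD (v - 1) 0 else 0) +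
    (if v + 2 < m then l.getD (v + 1) 0 else 0) + (if v = 2 then l.getD (m - 1) 0 else 0) +
    (if v + 1 = m then l.getD 2 0 else 0)

/-- Iterate the recursion of `addSeq` for `E_m`, as long as all values are non-negative. -/
def runList (m : ℕ) : ℕ → List ℕ → List ℕ → Option (List ℕ × List ℕ)
  | 0, a, b => some (a, b)
  | n + 1, a, b =>
    if (List.range m).all fun v => a.getD v 0 ≤ nbList m b v then
      runList m n b ((List.range m).map fun v => nbList m b v - a.getD v 0)
    else none

/-- The vector with entries prescribed by a list. -/
def ofList (m : ℕ) (l : List ℕ) (v : Fin m) : ℤ := (l.getD v 0 : ℕ)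

theorem addSeq_shift (a b : ι → ℤ) (n : ℕ) :
    addSeq adj a b (n + 1) = addSeq adj b (addSeq adj a b 2) n := by
  induction n using Nat.strong_induction_on with
  | _ n ih =>
    match n with
    | 0 => rfl
    | 1 => rfl
    | n + 2 =>
      rw [addSeq, ih (n + 1) (by omega), ih n (by omega)]
      rfl

theorem runList_spec (m : ℕ)
    (hnb : ∀ l v, nbSum (eAdj m) (ofList m l) v = (nbList m l v : ℕ)) (n : ℕ)
    (a b c d : List ℕ) (hr : runList m n a b = some (c, d)) :
    addSeq (eAdj m) (ofList m a) (ofList m b) n = ofList m c ∧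
    addSeq (eAdj m) (ofList m a) (ofList m b) (n + 1) = ofList m d ∧
    ∀ j ≤ n + 1, ∀ v, 0 ≤ addSeq (eAdj m) (ofList m a) (ofList m b) j v := by
  induction n generalizing a b with
  | zero =>
    simp only [runList, Option.some.injEq, Prod.mk.injEq] at hr
    obtain ⟨rfl, rfl⟩ := hr
    refine ⟨rfl, rfl, fun j hj v => ?_⟩
    obtain rfl | rfl : j = 0 ∨ j = 1 := by omega
    · exact Int.natCast_nonneg _
    · exact Int.natCast_nonneg _
  | succ n ih =>
    rw [runList] at hr
    split_ifs at hr with hc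
    have h2 : addSeq (eAdj m) (ofList m a) (ofList m b) 2 =
        ofList m ((List.range m).map fun v => nbList m b v - a.getD v 0) := by
      funext v
      simp only [List.all_eq_true, List.mem_range, decide_eq_true_eq] at hc
      have := hc v v.2
      simp only [addSeq, hnb]
      simp only [ofList, List.getD_eq_getElem?_getD] at this ⊢
      simp [Nat.cast_sub this]
    obtain ⟨h3, h4, h5⟩ := ih _ _ hr
    rw [← h2] at h3 h4 h5
    refine ⟨by rw [addSeq_shift, h3], by rw [addSeq_shift, h4], fun j hj v => ?_⟩
    match j with
    | 0 => exact Int.natCast_nonneg _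
    | j + 1 => rw [addSeq_shift]; exact h5 j (by omega) v

end Numerics

/-- The coordinates of a standard basis vector. -/
def unitList (m i : ℕ) : List ℕ := (List.range m).map fun v => if v = i then 1 else 0

theorem coxeterData_of_run (m h : ℕ) (star : Fin m → Fin m)
    (hh : 2 ≤ h) (hev : h % 2 = 0)
    (hnb : ∀ l v, nbSum (eAdj m) (ofList m l) v = (nbList m l v : ℕ))
    (hst : ∀ u, star (star u) = u)
    (hspread : ∀ σ, IsSlice (eAdj m) σ → ∀ u v, σ u + 3 ≤ σ v + h)
    (hpar : ∀ σ, IsSlice (eAdj m) σ → ∀ u, σ (star u) % 2 = σ u % 2)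
    (hrun : ∀ i : Fin m, runList m (h - 1) [] (unitList m i) =
      some (unitList m (star i), List.replicate m 0)) :
    CoxeterData (eAdj m) h star := by
  have e0 : ofList m [] = 0 := by funext v; simp [ofList]
  have e1 : ∀ i : Fin m, ofList m (unitList m i) = delta i := by
    intro i; funext v; simp [ofList, unitList, delta, Fin.ext_iff]
  have e2 : ofList m (List.replicate m 0) = 0 := by funext v; simp [ofList]
  have key := fun i => runList_spec m hnb _ _ _ _ _ (hrun i)
  simp only [e0, e1, e2, Nat.sub_add_cancel (show 1 ≤ h by omega)] at key
  refine ⟨?_, hh, hev, hspread, hpar, hst, fun i v n hn => (key i).2.2 n hn v,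
    fun i => (key i).1, fun i => (key i).2.1⟩
  intro u v; unfold eAdj; tauto

theorem eAdj_slice (m : ℕ) (hm : 6 ≤ m) (σ : Fin m → ℤ) (hσ : IsSlice (eAdj m) σ) :
    (∀ (n : ℕ) (hn : n + 2 < m), σ ⟨n + 1, by omega⟩ = σ ⟨n, by omega⟩ + 1 ∨
      σ ⟨n, by omega⟩ = σ ⟨n + 1, by omega⟩ + 1) ∧
    (σ ⟨m - 1, by omega⟩ = σ ⟨2, by omega⟩ + 1 ∨ σ ⟨2, by omega⟩ = σ ⟨m - 1, by omega⟩ + 1) := by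
  refine ⟨fun n hn => (hσ ⟨n, by omega⟩ ⟨n + 1, by omega⟩ ?_).symm,
    (hσ ⟨2, by omega⟩ ⟨m - 1, by omega⟩ ?_).symm⟩
  · exact Or.inl ⟨hn, rfl⟩
  · exact Or.inr (Or.inr (Or.inl ⟨rfl, Nat.sub_add_cancel (by omega)⟩))

theorem coxeterData_six : CoxeterData (eAdj 6) 12 ![4, 3, 2, 1, 0, 5] := by
  refine coxeterData_of_run 6 12 _ (by omega) rfl ?_ (by decide) ?_ ?_ (by decide +kernel)
  · intro l v
    rw [nbSum_eq]
    fin_cases v <;> simp [Fin.sum_univ_succ, eAdj, nbList, ofList] <;> ring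
  · intro σ hσ u v
    obtain ⟨h1, h2⟩ := eAdj_slice 6 (by omega) σ hσ
    have s0 := h1 0 (by omega)
    have s1 := h1 1 (by omega)
    have s2 := h1 2 (by omega)
    have s3 := h1 3 (by omega)
    clear h1 hσ
    fin_cases u <;> fin_cases v <;> simp at * <;> omega
  · intro σ hσ u
    obtain ⟨h1, h2⟩ := eAdj_slice 6 (by omega) σ hσ
    have s0 := h1 0 (by omega)
    have s1 := h1 1 (by omega)
    have s2 := h1 2 (by omega)
    have s3 := h1 3 (by omega)
    clear h1 hσ
    fin_cases u <;> simp at * <;> omega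

theorem coxeterData_seven : CoxeterData (eAdj 7) 18 id := by
  refine coxeterData_of_run 7 18 _ (by omega) rfl ?_ (fun _ => rfl) ?_ (fun _ _ _ => rfl)
    (by decide +kernel)
  · intro l v
    rw [nbSum_eq]
    fin_cases v <;> simp [Fin.sum_univ_succ, eAdj, nbList, ofList] <;> ring
  · intro σ hσ u v
    obtain ⟨h1, h2⟩ := eAdj_slice 7 (by omega) σ hσ
    have s0 := h1 0 (by omega)
    have s1 := h1 1 (by omega)
    have s2 := h1 2 (by omega)
    have s3 := h1 3 (by omega)
    have s4 := h1 4 (by omega)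
    clear h1 hσ
    fin_cases u <;> fin_cases v <;> simp at * <;> omega

theorem coxeterData_eight : CoxeterData (eAdj 8) 30 id := by
  refine coxeterData_of_run 8 30 _ (by omega) rfl ?_ (fun _ => rfl) ?_ (fun _ _ _ => rfl)
    (by decide +kernel)
  · intro l v
    rw [nbSum_eq]
    fin_cases v <;> simp [Fin.sum_univ_succ, eAdj, nbList, ofList] <;> ring
  · intro σ hσ u v
    obtain ⟨h1, h2⟩ := eAdj_slice 8 (by omega) σ hσ
    have s0 := h1 0 (by omega)
    have s1 := h1 1 (by omega)
    have s2 := h1 2 (by omega)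
    have s3 := h1 3 (by omega)
    have s4 := h1 4 (by omega)
    have s5 := h1 5 (by omega)
    clear h1 hσ
    fin_cases u <;> fin_cases v <;> simp at * <;> omega

/-- A family of finite dimensional vector spaces with linear maps between them. -/
structure TRep (k ι : Type) [Field k] where
  obj : ι → Type
  [grp : ∀ v, AddCommGroup (obj v)]
  [mod : ∀ v, Module k (obj v)]
  [fin : ∀ v, Module.Finite k (obj v)]
  map : ∀ u v, obj u →ₗ[k] obj v

attribute [instance] TRep.grp TRep.mod TRep.fin

section Rep

variable {k ι : Type} [Field k]

/-- Families of linear maps between the vector spaces of two representations. -/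
abbrev TRep.Fam (M N : TRep k ι) : Type := ∀ v, M.obj v →ₗ[k] N.obj v

/-- The identity family. -/
abbrev TRep.idFam (M : TRep k ι) : M.Fam M := fun _ => LinearMap.id

/-- The composition of two families. -/
abbrev TRep.Fam.comp {M N X : TRep k ι} (g : N.Fam X) (f : M.Fam N) : M.Fam X :=
  fun v => g v ∘ₗ f v

/-- Homomorphisms of representations of the quiver with arrows `r`. -/
def IsHom (r : ι → ι → Prop) (M N : TRep k ι) (f : M.Fam N) : Prop :=
  ∀ u v, r u v → ∀ x, f v (M.map u v x) = N.map u v (f u x)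

/-- All components of a family are bijective. -/
def FamBij {M N : TRep k ι} (f : M.Fam N) : Prop := ∀ v, Function.Bijective (f v)

/-- Indecomposable representations of the quiver with arrows `r`. -/
def IndecRep (r : ι → ι → Prop) (M : TRep k ι) : Prop :=
  (∃ v, ∃ x : M.obj v, x ≠ 0) ∧
    ∀ f : M.Fam M, IsHom r M M f → f.comp f = f → f = 0 ∨ f = M.idFam

theorem IsHom.comp {r : ι → ι → Prop} {M N X : TRep k ι} {g : N.Fam X} {f : M.Fam N}
    (hg : IsHom r N X g) (hf : IsHom r M N f) : IsHom r M X (g.comp f) := by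
  intro u v huv x
  simp [hf u v huv, hg u v huv]

theorem IsHom.id (r : ι → ι → Prop) (M : TRep k ι) : IsHom r M M M.idFam :=
  fun _ _ _ _ => rfl

theorem IsHom.zero (r : ι → ι → Prop) (M N : TRep k ι) : IsHom r M N 0 :=
  fun u v _ x => by simp

theorem FamBij.exists_inverse {r : ι → ι → Prop} {M N : TRep k ι} {f : M.Fam N}
    (hf : IsHom r M N f) (hb : FamBij f) :
    ∃ g : N.Fam M, IsHom r N M g ∧ g.comp f = M.idFam ∧ f.comp g = N.idFam := by
  let e : ∀ v, M.obj v ≃ₗ[k] N.obj v := fun v => LinearEquiv.ofBijective (f v) (hb v)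
  have he : ∀ v x, e v x = f v x := fun v x => rfl
  refine ⟨fun v => (e v).symm, fun u v huv x => ?_, ?_, ?_⟩
  · show (e v).symm _ = _
    rw [LinearEquiv.symm_apply_eq, he, hf u v huv, ← he]
    exact congrArg _ ((e u).apply_symm_apply x).symm
  · funext v
    ext x
    exact (e v).symm_apply_apply x
  · funext v
    ext x
    exact (e v).apply_symm_apply x

theorem famBij_of_inverse {M N : TRep k ι} {f : M.Fam N} {g : N.Fam M}
    (h1 : g.comp f = M.idFam) (h2 : f.comp g = N.idFam) : FamBij f := by
  intro v
  refine Function.bijective_iff_has_inverse.2 ⟨g v, fun x => ?_, fun x => ?_⟩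
  · exact LinearMap.congr_fun (congrFun h1 v) x
  · exact LinearMap.congr_fun (congrFun h2 v) x

theorem IndecRep.idFam_ne_zero {r : ι → ι → Prop} {M : TRep k ι} (hM : IndecRep r M) :
    M.idFam ≠ 0 := by
  obtain ⟨⟨v, x, hx⟩, -⟩ := hM
  exact fun h => hx (LinearMap.congr_fun (congrFun h v) x)

/-- The maps out of the vertices of `I` are jointly injective. -/
def InjAt (adj : ι → ι → Prop) (I : Set ι) (M : TRep k ι) : Prop :=
  ∀ v ∈ I, ∀ x : M.obj v, (∀ u, adj v u → M.map v u x = 0) → x = 0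

theorem IndecRep.simple_of_source {r : ι → ι → Prop} {M : TRep k ι} (hM : IndecRep r M) {v : ι}
    (hv : ∀ u, ¬ r u v) {x : M.obj v} (hx : x ≠ 0) (h0 : ∀ u, r v u → M.map v u x = 0) :
    (∀ w, w ≠ v → ∀ y : M.obj w, y = 0) ∧ ∀ y : M.obj v, ∃ c : k, y = c • x := by
  obtain ⟨φ, hφ⟩ : ∃ φ : M.obj v →ₗ[k] k, φ x = 1 := by
    obtain ⟨φ, hφ⟩ := Module.Projective.exists_dual_ne_zero k hx
    exact ⟨(φ x)⁻¹ • φ, by simp [hφ]⟩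
  let e : M.Fam M := Function.update 0 v (φ.smulRight x)
  have ev : e v = φ.smulRight x := Function.update_self ..
  have ew : ∀ w, w ≠ v → e w = 0 := fun w hw => Function.update_of_ne hw ..
  have hom : IsHom r M M e := by
    intro u w huw y
    have hw : w ≠ v := by rintro rfl; exact hv u huw
    rw [ew w hw]
    by_cases hu : u = v
    · subst hu
      rw [ev]
      simp [h0 w huw]
    · rw [ew u hu]; simp
  have idem : e.comp e = e := by
    funext w
    by_cases hw : w = v
    · subst hw
      ext y
      simp [ev, hφ]
    · ext y
      simp [ew w hw]
  rcases hM.2 e hom idem with h | h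
  · have := LinearMap.congr_fun (congrFun h v) x
    rw [ev] at this
    simp [hφ] at this
    exact absurd this hx
  · refine ⟨fun w hw y => ?_, fun y => ⟨φ y, ?_⟩⟩
    · have := LinearMap.congr_fun (congrFun h w) y
      rw [ew w hw] at this
      exact this.symm
    · have := LinearMap.congr_fun (congrFun h v) y
      rw [ev] at this
      exact this.symm

end Rep

section Reflection

variable {k ι : Type} [Field k] (adj : ι → ι → Prop) (I : Set ι)

/-- The structure maps from `v` to all of its neighbours. -/
def outMap (M : TRep k ι) (v : ι) : M.obj v →ₗ[k] ∀ u : {u // adj v u}, M.obj u :=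
  LinearMap.pi fun u => M.map v u

/-- The relations of the space at `v` of the reflected representation. -/
noncomputable def reflRel (M : TRep k ι) (v : ι) :
    Submodule k (M.obj v × ∀ u : {u // adj v u}, M.obj u) :=
  if v ∈ I then (⊤ : Submodule k (M.obj v)).prod (LinearMap.range (outMap adj M v))
  else (⊥ : Submodule k (M.obj v)).prod ⊤

/-- The space at `v` of the reflected representation: the cokernel of the maps out of `v` if
`v ∈ I`, the old space otherwise. -/
abbrev ReflObj (M : TRep k ι) (v : ι) : Type :=
  (M.obj v × ∀ u : {u // adj v u}, M.obj u) ⧸ reflRel adj I M v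

/-- The inclusion of the old space. -/
noncomputable def linc (M : TRep k ι) (v : ι) : M.obj v →ₗ[k] ReflObj adj I M v :=
  (reflRel adj I M v).mkQ ∘ₗ LinearMap.inl k _ _

/-- The projection from the sum of the neighbouring spaces. -/
noncomputable def lproj (M : TRep k ι) (v : ι) : (∀ u : {u // adj v u}, M.obj u) →ₗ[k] ReflObj adj I M v :=
  (reflRel adj I M v).mkQ ∘ₗ LinearMap.inr k _ _

variable {adj I}

theorem linc_bijective (M : TRep k ι) {v : ι} (hv : v ∉ I) :
    Function.Bijective (linc adj I M v) := by
  constructor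
  · rw [injective_iff_map_eq_zero]
    intro x hx
    rw [linc, LinearMap.comp_apply, Submodule.mkQ_apply, Submodule.Quotient.mk_eq_zero,
      reflRel, if_neg hv] at hx
    simpa using hx
  · intro y
    obtain ⟨⟨a, b⟩, rfl⟩ := Submodule.mkQ_surjective _ y
    refine ⟨a, ?_⟩
    simp only [linc, LinearMap.comp_apply]
    rw [← sub_eq_zero, ← map_sub, Submodule.mkQ_apply, Submodule.Quotient.mk_eq_zero]
    simp [reflRel, hv]

theorem lproj_surjective (M : TRep k ι) {v : ι} (hv : v ∈ I) :
    Function.Surjective (lproj adj I M v) := by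
  intro y
  obtain ⟨⟨a, b⟩, rfl⟩ := Submodule.mkQ_surjective _ y
  refine ⟨b, ?_⟩
  simp only [lproj, LinearMap.comp_apply]
  rw [← sub_eq_zero, ← map_sub, Submodule.mkQ_apply, Submodule.Quotient.mk_eq_zero]
  simp [reflRel, hv]

theorem lproj_eq_zero (M : TRep k ι) {v : ι} (hv : v ∈ I) (x : ∀ u : {u // adj v u}, M.obj u) :
    lproj adj I M v x = 0 ↔ ∃ z, outMap adj M v z = x := by
  rw [lproj, LinearMap.comp_apply, Submodule.mkQ_apply, Submodule.Quotient.mk_eq_zero,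
      reflRel, if_pos hv]
  simp

variable (adj I) in
/-- The identification of the spaces which are not changed. -/
noncomputable def lincEquiv (M : TRep k ι) (v : ι) (hv : v ∉ I) :
    M.obj v ≃ₗ[k] ReflObj adj I M v :=
  LinearEquiv.ofBijective (linc adj I M v) (linc_bijective M hv)

variable [Fintype ι]

variable (adj I) in
/-- The reflection of a representation at a set `I` of sources. -/
noncomputable def refl (M : TRep k ι) : TRep k ι where
  obj := ReflObj adj I M
  map u v := if hu : u ∈ I then 0 else
    (if v ∈ I then
      (if huv : adj v u then lproj adj I M v ∘ₗ
        LinearMap.single k (fun w : {w // adj v w} => M.obj w) ⟨u, huv⟩ else 0)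
      else linc adj I M v ∘ₗ M.map u v) ∘ₗ (lincEquiv adj I M u hu).symm.toLinearMap

variable (adj I) in
/-- The inclusion of an old space into the reflected representation. -/
noncomputable def inc (M : TRep k ι) (v : ι) : M.obj v →ₗ[k] (refl adj I M).obj v :=
  linc adj I M v

variable (adj I) in
/-- The projection onto a space of the reflected representation. -/
noncomputable def proj (M : TRep k ι) (v : ι) :
    (∀ u : {u // adj v u}, M.obj u) →ₗ[k] (refl adj I M).obj v :=
  lproj adj I M v

theorem inc_bijective (M : TRep k ι) {v : ι} (hv : v ∉ I) :
    Function.Bijective (inc adj I M v) := linc_bijective M hv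

theorem proj_surjective (M : TRep k ι) {v : ι} (hv : v ∈ I) :
    Function.Surjective (proj adj I M v) := lproj_surjective M hv

theorem proj_eq_zero (M : TRep k ι) {v : ι} (hv : v ∈ I) (x : ∀ u : {u // adj v u}, M.obj u) :
    proj adj I M v x = 0 ↔ ∃ z, outMap adj M v z = x := lproj_eq_zero M hv x

theorem refl_map_inc (M : TRep k ι) {u v : ι} (hu : u ∉ I) (hv : v ∉ I) (x : M.obj u) :
    (refl adj I M).map u v (inc adj I M u x) = inc adj I M v (M.map u v x) := by
  have h : (refl adj I M).map u v =
      (linc adj I M v ∘ₗ M.map u v) ∘ₗ (lincEquiv adj I M u hu).symm.toLinearMap := by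
    simp only [refl, dif_neg hu, if_neg hv]
    rfl
  rw [h]
  exact congrArg (fun y => linc adj I M v (M.map u v y))
    ((lincEquiv adj I M u hu).symm_apply_apply x)

theorem refl_map_proj (M : TRep k ι) {u v : ι} (hu : u ∉ I) (hv : v ∈ I) (huv : adj v u)
    (x : M.obj u) : (refl adj I M).map u v (inc adj I M u x) =
      proj adj I M v (Pi.single (M := fun w : {w // adj v w} => M.obj w) ⟨u, huv⟩ x) := by
  have h : (refl adj I M).map u v = (lproj adj I M v ∘ₗ
        LinearMap.single k (fun w : {w // adj v w} => M.obj w) ⟨u, huv⟩) ∘ₗ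
          (lincEquiv adj I M u hu).symm.toLinearMap := by
    simp only [refl, dif_neg hu, if_pos hv, dif_pos huv]
    rfl
  rw [h]
  exact congrArg (fun y => lproj adj I M v (LinearMap.single k _ _ y))
    ((lincEquiv adj I M u hu).symm_apply_apply x)

theorem proj_eq_sum (M : TRep k ι) {v : ι} (hI : ∀ u, adj v u → u ∉ I) (hv : v ∈ I)
    (x : ∀ u : {u // adj v u}, M.obj u) :
    proj adj I M v x =
      ∑ u : {u // adj v u}, (refl adj I M).map (u : ι) v (inc adj I M (u : ι) (x u)) := by
  conv_lhs => rw [← LinearMap.sum_single_apply (fun w : {w // adj v w} => M.obj w) x, map_sum]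
  exact Finset.sum_congr rfl fun u _ => (refl_map_proj M (hI u u.2) hv u.2 (x u)).symm

variable (adj I) in
/-- The family of maps induced on the reflected representations. -/
noncomputable def reflFam {M N : TRep k ι} (f : M.Fam N) : (refl adj I M).Fam (refl adj I N) :=
  fun v =>
    let F : (M.obj v × ∀ u : {u // adj v u}, M.obj u) →ₗ[k]
        (N.obj v × ∀ u : {u // adj v u}, N.obj u) :=
      (f v).prodMap (LinearMap.pi fun u => f u ∘ₗ LinearMap.proj u)
    if h : reflRel adj I M v ≤ (reflRel adj I N v).comap F then Submodule.mapQ _ _ F h else 0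

variable (adj I) in
/-- Compatibility of two quiver structures with a reflection at `I`. -/
structure ReflPair (r r' : ι → ι → Prop) : Prop where
  symm : ∀ u v, adj u v → adj v u
  nbr : ∀ v ∈ I, ∀ u, adj v u → u ∉ I
  out : ∀ v ∈ I, ∀ u, adj v u → r v u
  adj_of : ∀ u v, r u v → adj u v
  source : ∀ u v, r u v → v ∉ I
  into : ∀ v ∈ I, ∀ u, adj v u → r' u v
  adj_of' : ∀ u v, r' u v → adj u v
  sink : ∀ u v, r' u v → u ∉ I
  same : ∀ u v, u ∉ I → v ∉ I → (r u v ↔ r' u v)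

variable {r r' : ι → ι → Prop}

theorem reflFam_spec (R : ReflPair adj I r r') {M N : TRep k ι} {f : M.Fam N} (hf : IsHom r M N f) (v : ι) :
    (∀ x, reflFam adj I f v (inc adj I M v x) = inc adj I N v (f v x)) ∧
    ∀ x : ∀ u : {u // adj v u}, M.obj u,
      reflFam adj I f v (proj adj I M v x) = proj adj I N v (fun u => f u (x u)) := by
  let F : (M.obj v × ∀ u : {u // adj v u}, M.obj u) →ₗ[k]
      (N.obj v × ∀ u : {u // adj v u}, N.obj u) :=
    (f v).prodMap (LinearMap.pi fun u => f u ∘ₗ LinearMap.proj u)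
  have h : reflRel adj I M v ≤ (reflRel adj I N v).comap F := by
    rintro ⟨y, x⟩ hyx
    by_cases hv : v ∈ I
    · rw [reflRel, if_pos hv] at hyx
      obtain ⟨z, hz⟩ := hyx.2
      rw [Submodule.mem_comap, reflRel, if_pos hv]
      refine ⟨trivial, f v z, ?_⟩
      funext u
      have := congrFun hz u
      simp only [outMap, LinearMap.pi_apply] at this
      simp [F, outMap, ← hf v u (R.out v hv u u.2), this]
    · rw [reflRel, if_neg hv] at hyx
      rw [Submodule.mem_comap, reflRel, if_neg hv]
      have : y = 0 := hyx.1
      simp [F, this]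
  have e : reflFam adj I f v = Submodule.mapQ _ _ F h := dif_pos h
  rw [e]
  refine ⟨fun x => ?_, fun x => ?_⟩
  · refine (Submodule.mapQ_apply _ _ F _).trans ?_
    simp only [F, inc, linc]
    simp
    rfl
  · refine (Submodule.mapQ_apply _ _ F _).trans ?_
    simp only [F, proj, lproj]
    simp
    rfl

theorem reflFam_inc (R : ReflPair adj I r r') {M N : TRep k ι} {f : M.Fam N} (hf : IsHom r M N f) (v : ι) (x : M.obj v) :
    reflFam adj I f v (inc adj I M v x) = inc adj I N v (f v x) := (reflFam_spec R hf v).1 x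

theorem reflFam_proj (R : ReflPair adj I r r') {M N : TRep k ι} {f : M.Fam N} (hf : IsHom r M N f) (v : ι)
    (x : ∀ u : {u // adj v u}, M.obj u) :
    reflFam adj I f v (proj adj I M v x) = proj adj I N v (fun u => f u (x u)) :=
  (reflFam_spec R hf v).2 x

theorem ReflPair.hom_ext (R : ReflPair adj I r r') {M X : TRep k ι} {f g : (refl adj I M).Fam X}
    (hf : IsHom r' _ _ f) (hg : IsHom r' _ _ g)
    (h : ∀ u ∉ I, ∀ x, f u (inc adj I M u x) = g u (inc adj I M u x)) : f = g := by
  funext v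
  ext y
  by_cases hv : v ∈ I
  · obtain ⟨x, rfl⟩ := proj_surjective M hv y
    rw [proj_eq_sum M (R.nbr v hv) hv, map_sum, map_sum]
    refine Finset.sum_congr rfl fun u _ => ?_
    rw [hf _ _ (R.into v hv u u.2), hg _ _ (R.into v hv u u.2), h _ (R.nbr v hv u u.2)]
  · obtain ⟨x, rfl⟩ := (inc_bijective M hv).2 y
    exact h v hv x

theorem ReflPair.isHom (R : ReflPair adj I r r') {M N : TRep k ι} {f : M.Fam N} (hf : IsHom r M N f) :
    IsHom r' (refl adj I M) (refl adj I N) (reflFam adj I f) := by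
  intro u v huv y
  have hu := R.sink u v huv
  obtain ⟨x, rfl⟩ := (inc_bijective M hu).2 y
  rw [reflFam_inc R hf]
  by_cases hv : v ∈ I
  · have hvu := R.symm _ _ (R.adj_of' u v huv)
    rw [refl_map_proj M hu hv hvu, refl_map_proj N hu hv hvu, reflFam_proj R hf]
    congr 1
    funext w
    exact (Pi.apply_single (fun w : {w // adj v w} => f (w : ι)) (fun w => map_zero _) _ _ _)
  · rw [refl_map_inc M hu hv, refl_map_inc N hu hv, reflFam_inc R hf,
      hf u v ((R.same u v hu hv).2 huv)]

theorem ReflPair.reflFam_id (R : ReflPair adj I r r') (M : TRep k ι) : reflFam adj I M.idFam = (refl adj I M).idFam := by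
  refine R.hom_ext (R.isHom (IsHom.id r M)) (IsHom.id r' _) fun u _ x => ?_
  rw [reflFam_inc R (IsHom.id r M)]
  rfl

theorem ReflPair.reflFam_zero (R : ReflPair adj I r r') (M N : TRep k ι) : reflFam adj I (0 : M.Fam N) = 0 := by
  refine R.hom_ext (R.isHom (IsHom.zero r M N)) (IsHom.zero r' _ _) fun u _ x => ?_
  rw [reflFam_inc R (IsHom.zero r M N)]
  exact map_zero _

theorem ReflPair.reflFam_comp (R : ReflPair adj I r r') {M N X : TRep k ι} {g : N.Fam X} {f : M.Fam N}
    (hg : IsHom r N X g) (hf : IsHom r M N f) :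
    reflFam adj I (g.comp f) = (reflFam adj I g).comp (reflFam adj I f) := by
  refine R.hom_ext (R.isHom (hg.comp hf)) ((R.isHom hg).comp (R.isHom hf)) fun u _ x => ?_
  rw [reflFam_inc R (hg.comp hf)]
  simp [reflFam_inc R hg, reflFam_inc R hf]

theorem ReflPair.faithful (R : ReflPair adj I r r') {M N : TRep k ι} (hN : InjAt adj I N) {f g : M.Fam N}
    (hf : IsHom r M N f) (hg : IsHom r M N g) (h : reflFam adj I f = reflFam adj I g) :
    f = g := by
  have key : ∀ u ∉ I, ∀ x, f u x = g u x := fun u hu x => by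
    apply (inc_bijective N hu).1
    rw [← reflFam_inc R hf, ← reflFam_inc R hg, h]
  funext v
  ext x
  by_cases hv : v ∈ I
  · rw [← sub_eq_zero]
    refine hN v hv _ fun u hu => ?_
    rw [map_sub, ← hf v u (R.out v hv u hu), ← hg v u (R.out v hv u hu), sub_eq_zero]
    exact key u (R.nbr v hv u hu) _
  · exact key v hv x

theorem ReflPair.full (R : ReflPair adj I r r') {M N : TRep k ι} (hN : InjAt adj I N)
    {g : (refl adj I M).Fam (refl adj I N)} (hg : IsHom r' _ _ g) :
    ∃ f : M.Fam N, IsHom r M N f ∧ reflFam adj I f = g := by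
  have hex : ∀ v, ∃ F : M.obj v →ₗ[k] N.obj v, v ∉ I →
      ∀ x, inc adj I N v (F x) = g v (inc adj I M v x) := by
    intro v
    by_cases hv : v ∈ I
    · exact ⟨0, fun h => absurd hv h⟩
    · let e := LinearEquiv.ofBijective (inc adj I N v) (inc_bijective N hv)
      exact ⟨e.symm.toLinearMap ∘ₗ g v ∘ₗ inc adj I M v, fun _ x => e.apply_symm_apply _⟩
  choose F hF using hex
  have hex' : ∀ v, ∃ F' : M.obj v →ₗ[k] N.obj v, (v ∉ I → F' = F v) ∧
      (v ∈ I → ∀ z u, adj v u → N.map v u (F' z) = F u (M.map v u z)) := by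
    intro v
    by_cases hv : v ∈ I
    · have hinj : Function.Injective (outMap adj N v) := by
        rw [injective_iff_map_eq_zero]
        exact fun x hx => hN v hv x fun u hu => congrFun hx ⟨u, hu⟩
      let Φ : M.obj v →ₗ[k] ∀ u : {u // adj v u}, N.obj u :=
        LinearMap.pi fun u => F u ∘ₗ M.map v u
      have hΦ : ∀ z, Φ z ∈ LinearMap.range (outMap adj N v) := by
        intro z
        refine (proj_eq_zero N hv _).1 ?_
        have h0 := (proj_eq_zero M hv (outMap adj M v z)).2 ⟨z, rfl⟩
        rw [proj_eq_sum M (R.nbr v hv) hv] at h0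
        have h1 := congrArg (g v) h0
        rw [map_sum, map_zero] at h1
        rw [proj_eq_sum N (R.nbr v hv) hv, ← h1]
        refine Finset.sum_congr rfl fun u _ => ?_
        rw [hg _ _ (R.into v hv u u.2), ← hF u (R.nbr v hv u u.2)]
        rfl
      let e := LinearEquiv.ofInjective (outMap adj N v) hinj
      refine ⟨e.symm.toLinearMap ∘ₗ Φ.codRestrict _ hΦ, fun h => absurd hv h,
        fun _ z u hu => ?_⟩
      have := congrArg Subtype.val (e.apply_symm_apply (Φ.codRestrict _ hΦ z))
      exact congrFun this ⟨u, hu⟩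
    · exact ⟨F v, fun _ => rfl, fun h => absurd h hv⟩
  choose f hf hf' using hex'
  have hom : IsHom r M N f := by
    intro u v huv x
    have hv := R.source u v huv
    by_cases hu : u ∈ I
    · rw [hf' u hu x v (R.adj_of u v huv), hf v hv]
    · apply (inc_bijective N hv).1
      rw [hf v hv, hF v hv, ← refl_map_inc M hu hv, hg u v ((R.same u v hu hv).1 huv),
        ← refl_map_inc N hu hv, hf u hu, hF u hu]
  refine ⟨f, hom, R.hom_ext (R.isHom hom) hg fun u hu x => ?_⟩
  rw [reflFam_inc R hom, hf u hu, hF u hu]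

theorem ReflPair.famBij (R : ReflPair adj I r r') {M N : TRep k ι} (hM : InjAt adj I M) (hN : InjAt adj I N) {f : M.Fam N}
    (hf : IsHom r M N f) (hb : FamBij (reflFam adj I f)) : FamBij f := by
  obtain ⟨g', hg', h1, h2⟩ := hb.exists_inverse (R.isHom hf)
  obtain ⟨g, hg, rfl⟩ := R.full hM hg'
  refine famBij_of_inverse (g := g) ?_ ?_
  · refine R.faithful hM (hg.comp hf) (IsHom.id r M) ?_
    rw [R.reflFam_comp hg hf, h1, R.reflFam_id]
  · refine R.faithful hN (hf.comp hg) (IsHom.id r N) ?_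
    rw [R.reflFam_comp hf hg, h2, R.reflFam_id]

theorem ReflPair.indec (R : ReflPair adj I r r') {M : TRep k ι} (hI : InjAt adj I M) (hM : IndecRep r M) :
    IndecRep r' (refl adj I M) := by
  constructor
  · by_contra! h
    refine hM.idFam_ne_zero (R.faithful hI (IsHom.id r M) (IsHom.zero r M M) ?_)
    funext v
    ext x
    rw [h v (reflFam adj I M.idFam v x), h v (reflFam adj I (0 : M.Fam M) v x)]
  · intro e he hee
    obtain ⟨f, hf, rfl⟩ := R.full hI he
    rw [← R.reflFam_comp hf hf] at hee
    rcases hM.2 f hf (R.faithful hI (hf.comp hf) hf hee) with rfl | rfl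
    · exact Or.inl (R.reflFam_zero M M)
    · exact Or.inr (R.reflFam_id M)

theorem finrank_refl_of_notMem (M : TRep k ι) {v : ι} (hv : v ∉ I) :
    Module.finrank k ((refl adj I M).obj v) = Module.finrank k (M.obj v) :=
  (LinearEquiv.ofBijective (inc adj I M v) (inc_bijective M hv)).finrank_eq.symm

theorem finrank_refl_of_mem (M : TRep k ι) (hM : InjAt adj I M) {v : ι} (hv : v ∈ I) :
    (Module.finrank k ((refl adj I M).obj v) : ℤ) =
      nbSum adj (fun u => Module.finrank k (M.obj u)) v - Module.finrank k (M.obj v) := by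
  have hinj : Function.Injective (outMap adj M v) := by
    rw [injective_iff_map_eq_zero]
    exact fun x hx => hM v hv x fun u hu => congrFun hx ⟨u, hu⟩
  have h1 := LinearMap.finrank_range_add_finrank_ker (proj adj I M v)
  have h2 : LinearMap.ker (proj adj I M v) = LinearMap.range (outMap adj M v) := by
    ext x
    exact proj_eq_zero M hv x
  rw [h2, LinearMap.finrank_range_of_inj hinj, LinearMap.range_eq_top.2 (proj_surjective M hv),
    finrank_top, Module.finrank_pi_fintype] at h1
  rw [nbSum]
  have := congrArg (Nat.cast : ℕ → ℤ) h1
  push_cast at this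
  linarith

end Reflection

/-- The arrows of the orientation of a graph by decreasing height. -/
def arr {ι : Type} (adj : ι → ι → Prop) (σ : ι → ℤ) (u v : ι) : Prop := adj u v ∧ σ v < σ u

/-- Lower the vertices of height `T` by two. -/
noncomputable def down {ι : Type} (σ : ι → ℤ) (T : ℤ) (v : ι) : ℤ := if σ v = T then T - 2 else σ v

/-- The dimension vector of a representation. -/
noncomputable def TRep.dim {k ι : Type} [Field k] (M : TRep k ι) (v : ι) : ℤ :=
  Module.finrank k (M.obj v)

/-- Chains of `n` non-isomorphisms between representations which satisfy `C`, together with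
their composition. -/
inductive NChain {k ι : Type} [Field k] (r : ι → ι → Prop) (C : TRep k ι → Prop) :
    ℕ → ∀ M N : TRep k ι, M.Fam N → Prop
  | nil (M : TRep k ι) (hM : C M) : NChain r C 0 M M M.idFam
  | cons {n : ℕ} {M N X : TRep k ι} {f : M.Fam N} {g : N.Fam X} (hM : C M) (hf : IsHom r M N f)
      (hb : ¬ FamBij f) (hg : NChain r C n N X g) : NChain r C (n + 1) M X (g.comp f)

section Chain

variable {k ι : Type} [Field k] {r : ι → ι → Prop} {C : TRep k ι → Prop}

theorem NChain.isHom {n : ℕ} {M N : TRep k ι} {f : M.Fam N} (h : NChain r C n M N f) :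
    IsHom r M N f := by
  induction h with
  | nil M hM => exact IsHom.id r M
  | cons hM hf hb hg ih => exact ih.comp hf

theorem NChain.source {n : ℕ} {M N : TRep k ι} {f : M.Fam N} (h : NChain r C n M N f) :
    C M := by
  cases h <;> assumption

theorem NChain.target {n : ℕ} {M N : TRep k ι} {f : M.Fam N} (h : NChain r C n M N f) :
    C N := by
  induction h <;> assumption

theorem NChain.mono {C' : TRep k ι → Prop} (hC : ∀ M, C M → C' M) {n : ℕ} {M N : TRep k ι}
    {f : M.Fam N} (h : NChain r C n M N f) : NChain r C' n M N f := by
  induction h with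
  | nil M hM => exact .nil M (hC M hM)
  | cons hM hf hb hg ih => exact .cons (hC _ hM) hf hb ih

end Chain

section Slice

variable {ι : Type} {adj : ι → ι → Prop} {σ : ι → ℤ} {T : ℤ}

theorem IsSlice.down (hs : IsSlice adj σ) (hT : ∀ v, σ v ≤ T) : IsSlice adj (down σ T) := by
  intro u v huv
  have h1 := hs u v huv
  have h2 := hT u
  have h3 := hT v
  unfold DynkinRep.down
  split_ifs <;> omega

theorem down_le (hT : ∀ v, σ v ≤ T) (v : ι) : down σ T v ≤ T - 1 := by
  have h3 := hT v
  unfold down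
  split_ifs <;> omega

theorem reflPair_down (hsymm : ∀ u v, adj u v → adj v u) (hs : IsSlice adj σ)
    (hT : ∀ v, σ v ≤ T) :
    ReflPair adj {v | σ v = T} (arr adj σ) (arr adj (down σ T)) where
  symm := hsymm
  nbr v hv u hu := by
    have h1 := hs v u hu
    simp only [Set.mem_ofPred_eq] at *
    omega
  out v hv u hu := by
    have h1 := hs v u hu
    have h2 := hT u
    simp only [Set.mem_ofPred_eq] at *
    exact ⟨hu, by omega⟩
  adj_of u v h := h.1
  source u v h hv := by
    have h2 := hT u
    have h3 := h.2
    simp only [Set.mem_ofPred_eq] at *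
    omega
  into v hv u hu := by
    have h1 := hs v u hu
    have h2 := hT u
    simp only [Set.mem_ofPred_eq] at *
    refine ⟨hsymm _ _ hu, ?_⟩
    unfold down
    split_ifs <;> omega
  adj_of' u v h := h.1
  sink u v h hu := by
    have h1 := hs u v h.1
    have h2 := hT v
    have h3 := h.2
    simp only [Set.mem_ofPred_eq] at *
    unfold down at h3
    split_ifs at h3 <;> omega
  same u v hu hv := by
    simp only [Set.mem_ofPred_eq] at *
    simp [arr, down, hu, hv]

end Slice

section Upper

variable {k ι : Type} [Field k] [Fintype ι] {adj : ι → ι → Prop}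

/-- The formal reflection of a dimension vector. -/
noncomputable def dimRefl (adj : ι → ι → Prop) (σ : ι → ℤ) (T : ℤ) (d : ι → ℤ) (v : ι) : ℤ :=
  if σ v = T then nbSum adj d v - d v else d v

/-- The representation survives `n` steps of the reflection process. -/
def Surv (adj : ι → ι → Prop) : ℕ → (ι → ℤ) → ℤ → TRep k ι → Prop
  | 0, _, _, _ => True
  | n + 1, σ, T, M => InjAt adj {v | σ v = T} M ∧
      Surv adj n (down σ T) (T - 1) (refl adj {v | σ v = T} M)

/-- The dimension vector stays non-negative in `n` steps of the reflection process. -/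
def Pos (adj : ι → ι → Prop) : ℕ → (ι → ℤ) → ℤ → (ι → ℤ) → Prop
  | 0, _, _, d => ∀ v, 0 ≤ d v
  | n + 1, σ, T, d => (∀ v, 0 ≤ d v) ∧ Pos adj n (down σ T) (T - 1) (dimRefl adj σ T d)

theorem Surv.mono {n m : ℕ} (h : n ≤ m) {σ : ι → ℤ} {T : ℤ} {M : TRep k ι}
    (hM : Surv adj m σ T M) : Surv adj n σ T M := by
  induction n generalizing m σ T M with
  | zero => trivial
  | succ n ih =>
    obtain ⟨m, rfl⟩ : ∃ l, m = l + 1 := ⟨m - 1, by omega⟩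
    exact ⟨hM.1, ih (by omega) hM.2⟩

theorem dim_refl {σ : ι → ℤ} {T : ℤ} {M : TRep k ι} (hM : InjAt adj {v | σ v = T} M) :
    (refl adj {v | σ v = T} M).dim = dimRefl adj σ T M.dim := by
  funext v
  by_cases hv : σ v = T
  · rw [dimRefl, if_pos hv]
    exact finrank_refl_of_mem M hM hv
  · rw [dimRefl, if_neg hv]
    exact congrArg Nat.cast (finrank_refl_of_notMem M hv)

theorem Surv.pos {n : ℕ} {σ : ι → ℤ} {T : ℤ} {M : TRep k ι} (hM : Surv adj n σ T M) :
    Pos adj n σ T M.dim := by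
  induction n generalizing σ T M with
  | zero => exact fun v => Int.natCast_nonneg _
  | succ n ih =>
    refine ⟨fun v => Int.natCast_nonneg _, ?_⟩
    rw [← dim_refl hM.1]
    exact ih hM.2

theorem Pos.exists_addSeq {n : ℕ} {σ : ι → ℤ} {T : ℤ} {d : ι → ℤ} (hp : Pos adj n σ T d)
    (hs : IsSlice adj σ) (hT : ∀ v, σ v ≤ T) (b : ℤ) (hb : b = T - n - 1) (hσ : ∀ v, b ≤ σ v) :
    ∃ y₀ y₁ : ι → ℤ, (∀ v, 0 ≤ y₀ v) ∧ ∀ v, d v = addSeq adj y₀ y₁ (σ v - b).toNat v := by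
  induction n generalizing σ T d with
  | zero =>
    refine ⟨d, d, hp, fun v => ?_⟩
    have h1 := hT v
    have h2 := hσ v
    obtain h | h : (σ v - b).toNat = 0 ∨ (σ v - b).toNat = 1 := by omega
    · rw [h]; rfl
    · rw [h]; rfl
  | succ n ih =>
    obtain ⟨y₀, y₁, h0, hy⟩ := ih hp.2 (hs.down hT) (down_le hT) (by push_cast at hb ⊢; omega)
      (fun v => by
        have h1 := hσ v
        unfold down
        split_ifs <;> push_cast at hb <;> omega)
    refine ⟨y₀, y₁, h0, fun v => ?_⟩
    push_cast at hb
    by_cases hv : σ v = T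
    · have hn : ∀ u, adj v u → d u = addSeq adj y₀ y₁ (n + 1) u := by
        intro u hu
        have h1 := hs v u hu
        have h2 := hT u
        have h3 : σ u ≠ T := by omega
        have h4 := hy u
        rw [dimRefl, if_neg h3, down, if_neg h3, show (σ u - b).toNat = n + 1 by omega] at h4
        exact h4
      have h4 := hy v
      rw [dimRefl, if_pos hv, down, if_pos hv, show (T - 2 - b).toNat = n by omega] at h4
      rw [show (σ v - b).toNat = n + 2 by omega]
      show d v = nbSum adj (addSeq adj y₀ y₁ (n + 1)) v - addSeq adj y₀ y₁ n v
      rw [← h4]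
      have : nbSum adj (addSeq adj y₀ y₁ (n + 1)) v = nbSum adj d v :=
        Finset.sum_congr rfl fun u _ => (hn u u.2).symm
      rw [this]
      ring
    · have h4 := hy v
      rwa [dimRefl, if_neg hv, down, if_neg hv] at h4

variable {h : ℕ} {star : ι → ι}

theorem CoxeterData.nonpos_top (D : CoxeterData adj h star) {σ : ι → ℤ} {T : ℤ} {d : ι → ℤ} (hp : Pos adj (h - 1) σ T d)
    (hs : IsSlice adj σ) (hT : ∀ v, σ v ≤ T) {i : ι} (hi : σ i = T) : d i ≤ 0 := by
  have h2 := D.two_le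
  obtain ⟨y₀, y₁, h0, hy⟩ := hp.exists_addSeq hs hT (T - h) (by omega) (fun v => by
    have := D.spread σ hs i v
    omega)
  rw [hy i, show (σ i - (T - h)).toNat = h by omega, D.period]
  have := h0 (star i)
  omega

theorem CoxeterData.nonpos (D : CoxeterData adj h star) {j : ℕ} {σ : ι → ℤ} {T : ℤ} {d : ι → ℤ}
    (hp : Pos adj (j + (h - 1)) σ T d) (hs : IsSlice adj σ) (hT : ∀ v, σ v ≤ T) {i : ι}
    (hi : σ i = T - j) : d i ≤ 0 := by
  induction j generalizing σ T d with
  | zero => exact D.nonpos_top (by simpa using hp) hs hT (by simpa using hi)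
  | succ j ih =>
    have hne : σ i ≠ T := by push_cast at hi; omega
    rw [show j + 1 + (h - 1) = j + (h - 1) + 1 by omega] at hp
    have := ih hp.2 (hs.down hT) (down_le hT) (by
      rw [down, if_neg hne, hi]
      push_cast
      ring)
    rwa [dimRefl, if_neg hne] at this

theorem TRep.eq_zero_of_dim {M : TRep k ι} {v : ι} (hM : M.dim v ≤ 0) (x : M.obj v) : x = 0 := by
  have : Module.finrank k (M.obj v) = 0 := by
    have : (Module.finrank k (M.obj v) : ℤ) ≤ 0 := hM
    omega
  have := Module.finrank_zero_iff.1 this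
  exact Subsingleton.elim x 0

theorem CoxeterData.not_surv (D : CoxeterData adj h star) {σ : ι → ℤ} {T : ℤ} {M : TRep k ι} {r : ι → ι → Prop}
    (hM : IndecRep r M) (hs : IsSlice adj σ) (hT : ∀ v, σ v ≤ T) {i : ι} (hi : σ i = T) :
    ¬ Surv adj (2 * h) σ T M := by
  intro hS
  obtain ⟨⟨v, x, hx⟩, -⟩ := hM
  refine hx (TRep.eq_zero_of_dim ?_ x)
  have h1 := D.spread σ hs i v
  have h2 := hT v
  exact D.nonpos (j := (T - σ v).toNat) (hS.mono (by omega)).pos hs hT (by omega)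

theorem exists_of_not_injAt {σ : ι → ℤ} {T : ℤ} {M : TRep k ι} (hT : ∀ v, σ v ≤ T)
    (hM : IndecRep (arr adj σ) M) (hI : ¬ InjAt adj {v | σ v = T} M) :
    ∃ v, σ v = T ∧ ∃ x : M.obj v, x ≠ 0 ∧ (∀ u, adj v u → M.map v u x = 0) ∧
      (∀ w, w ≠ v → ∀ y : M.obj w, y = 0) ∧ ∀ y : M.obj v, ∃ c : k, y = c • x := by
  simp only [InjAt] at hI
  push Not at hI
  obtain ⟨v, hv, x, hx, hx0⟩ := hI
  refine ⟨v, hv, x, hx0, hx, hM.simple_of_source (fun u hu => ?_) hx0 fun u hu => hx u hu.1⟩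
  have h1 := hT u
  have h2 := hu.2
  simp only [Set.mem_ofPred_eq] at hv
  omega

theorem injAt_of_hom {σ : ι → ℤ} {T : ℤ}
    (hT : ∀ v, σ v ≤ T) {M N : TRep k ι} (hM : IndecRep (arr adj σ) M)
    (hN : IndecRep (arr adj σ) N) {g : M.Fam N} (hg : IsHom (arr adj σ) M N g) (hg0 : g ≠ 0)
    (hb : ¬ FamBij g) : InjAt adj {v | σ v = T} M := by
  by_contra hI
  obtain ⟨v, hv, x, hx0, hx, hw, hc⟩ := exists_of_not_injAt hT hM hI
  have hgx : g v x ≠ 0 := by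
    intro hgx
    apply hg0
    funext w
    ext y
    by_cases hwv : w = v
    · subst hwv
      obtain ⟨c, rfl⟩ := hc y
      simp [hgx]
    · simp [hw w hwv y]
  have hsrc : ∀ u, ¬ arr adj σ u v := fun u hu => by
    have h1 := hT u
    have h2 := hu.2
    omega
  obtain ⟨hw', hc'⟩ := hN.simple_of_source hsrc hgx fun u hu => by
    rw [← hg v u hu, hx u hu.1, map_zero]
  apply hb
  intro w
  by_cases hwv : w = v
  · subst hwv
    constructor
    · rw [injective_iff_map_eq_zero]
      intro y hy
      obtain ⟨c, rfl⟩ := hc y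
      rw [map_smul, smul_eq_zero] at hy
      simp [hy.resolve_right hgx]
    · intro y
      obtain ⟨c, rfl⟩ := hc' y
      exact ⟨c • x, map_smul ..⟩
  · exact ⟨fun a b _ => (hw w hwv a).trans (hw w hwv b).symm,
      fun y => ⟨0, by rw [map_zero]; exact (hw' w hwv y).symm⟩⟩

theorem surv_succ_of_hom (hsymm : ∀ u v, adj u v → adj v u) {n : ℕ} {σ : ι → ℤ} {T : ℤ}
    (hs : IsSlice adj σ) (hT : ∀ v, σ v ≤ T) {M N : TRep k ι} (hM : IndecRep (arr adj σ) M)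
    (hN : IndecRep (arr adj σ) N) {g : M.Fam N} (hg : IsHom (arr adj σ) M N g) (hg0 : g ≠ 0)
    (hb : ¬ FamBij g) (hS : Surv adj n σ T N) : Surv adj (n + 1) σ T M := by
  have hMI := injAt_of_hom hT hM hN hg hg0 hb
  have R := reflPair_down hsymm hs hT
  induction n generalizing σ T M N with
  | zero => exact ⟨hMI, trivial⟩
  | succ n ih =>
    refine ⟨hMI, ?_⟩
    have hb' : ¬ FamBij (reflFam adj {v | σ v = T} g) := fun h => hb (R.famBij hMI hS.1 hg h)
    have hg0' : reflFam adj {v | σ v = T} g ≠ 0 := fun h => hg0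
      (R.faithful hS.1 hg (IsHom.zero _ M N) (h.trans (R.reflFam_zero M N).symm))
    have hM' := R.indec hMI hM
    have hN' := R.indec hS.1 hN
    exact ih (hs.down hT) (down_le hT) hM' hN' (R.isHom hg) hg0' hb' hS.2
      (injAt_of_hom (down_le hT) hM' hN' (R.isHom hg) hg0' hb')
      (reflPair_down hsymm (hs.down hT) (down_le hT))

theorem CoxeterData.injAt_target (D : CoxeterData adj h star) {σ : ι → ℤ} {T : ℤ} (hs : IsSlice adj σ)
    (hT : ∀ v, σ v ≤ T) {M N : TRep k ι} (hN : IndecRep (arr adj σ) N) {g : M.Fam N}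
    (hg0 : g ≠ 0) (hM : Surv adj (h - 1) σ T M) : InjAt adj {v | σ v = T} N := by
  by_contra hI
  obtain ⟨v, hv, x, hx0, hx, hw, hc⟩ := exists_of_not_injAt hT hN hI
  apply hg0
  funext w
  ext y
  by_cases hwv : w = v
  · subst hwv
    rw [TRep.eq_zero_of_dim (D.nonpos_top hM.pos hs hT hv) y]
    simp
  · exact hw w hwv _

theorem CoxeterData.not_surv_of_hom (D : CoxeterData adj h star) {n : ℕ} {σ : ι → ℤ} {T : ℤ} (hs : IsSlice adj σ)
    (hT : ∀ v, σ v ≤ T) {M N : TRep k ι} (hN : IndecRep (arr adj σ) N) {g : M.Fam N}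
    (hg : IsHom (arr adj σ) M N g) (hg0 : g ≠ 0) (hS : ¬ Surv adj (n + 1) σ T N) :
    ¬ Surv adj (n + (h - 1)) σ T M := by
  intro hM
  induction n generalizing σ T M N with
  | zero => exact hS ⟨D.injAt_target hs hT hN hg0 (hM.mono (by omega)), trivial⟩
  | succ n ih =>
    have R := reflPair_down D.symm hs hT
    have hNI := D.injAt_target hs hT hN hg0 (hM.mono (by omega))
    rw [show n + 1 + (h - 1) = n + (h - 1) + 1 by omega] at hM
    exact ih (hs.down hT) (down_le hT) (R.indec hNI hN) (R.isHom hg)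
      (fun h => hg0 (R.faithful hNI hg (IsHom.zero _ M N) (h.trans (R.reflFam_zero M N).symm)))
      (fun h => hS ⟨hNI, h⟩) hM.2

theorem CoxeterData.chain_le (D : CoxeterData adj h star) {σ : ι → ℤ} {T : ℤ} (hs : IsSlice adj σ)
    (hT : ∀ v, σ v ≤ T) {i : ι} (hi : σ i = T) {n : ℕ} {M N : TRep k ι} {f : M.Fam N}
    (hf : NChain (arr adj σ) (IndecRep (arr adj σ)) n M N f) (hf0 : f ≠ 0) : n ≤ h - 2 := by
  have hex : ∃ κ, ¬ Surv adj κ σ T N := ⟨_, D.not_surv hf.target hs hT hi⟩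
  obtain ⟨κ, hκ⟩ : ∃ κ, Nat.find hex = κ + 1 := by
    refine ⟨Nat.find hex - 1, ?_⟩
    have : Nat.find hex ≠ 0 := fun h0 => by
      have := Nat.find_spec hex
      rw [h0] at this
      exact this trivial
    omega
  have h1 : ¬ Surv adj (κ + 1) σ T N := hκ ▸ Nat.find_spec hex
  have h2 : Surv adj κ σ T N := not_not.1 (Nat.find_min hex (by omega))
  have h3 := D.not_surv_of_hom hs hT hf.target hf.isHom hf0 h1
  have key : Surv adj (n + κ) σ T M := by
    clear h3 hκ h1 hex
    induction hf with
    | nil M hM => simpa using h2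
    | @cons n M X N f g hM hf hb hg ih =>
      have hg0 : g ≠ 0 := by
        rintro rfl
        exact hf0 (by funext v; ext x; simp)
      have hf0' : f ≠ 0 := by
        rintro rfl
        exact hf0 (by funext v; ext x; simp)
      rw [show n + 1 + κ = n + κ + 1 by omega]
      exact surv_succ_of_hom D.symm hs hT hM hg.source hf hf0' hb (ih hg0 h2)
  have := D.two_le
  by_contra hn
  exact h3 (key.mono (by omega))

end Upper

/-- Raise the vertices of height `B` by two. -/
noncomputable def up {ι : Type} (τ : ι → ℤ) (B : ℤ) (v : ι) : ℤ := if τ v = B then B + 2 else τ v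

section Slice

variable {ι : Type} {adj : ι → ι → Prop} {τ : ι → ℤ} {B : ℤ}

theorem IsSlice.up (hs : IsSlice adj τ) (hB : ∀ v, B ≤ τ v) : IsSlice adj (up τ B) := by
  intro u v huv
  have h1 := hs u v huv
  have h2 := hB u
  have h3 := hB v
  unfold DynkinRep.up
  split_ifs <;> omega

theorem le_up (hB : ∀ v, B ≤ τ v) (v : ι) : B + 1 ≤ up τ B v := by
  have h3 := hB v
  unfold up
  split_ifs <;> omega

theorem reflPair_up (hsymm : ∀ u v, adj u v → adj v u) (hs : IsSlice adj τ)
    (hB : ∀ v, B ≤ τ v) :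
    ReflPair adj {v | τ v = B} (arr adj (up τ B)) (arr adj τ) where
  symm := hsymm
  nbr v hv u hu := by
    have h1 := hs v u hu
    simp only [Set.mem_ofPred_eq] at *
    omega
  out v hv u hu := by
    have h1 := hs v u hu
    have h2 := hB u
    simp only [Set.mem_ofPred_eq] at *
    refine ⟨hu, ?_⟩
    unfold up
    split_ifs <;> omega
  adj_of u v h := h.1
  source u v h hv := by
    have h1 := hs u v h.1
    have h2 := hB u
    have h3 := h.2
    simp only [Set.mem_ofPred_eq] at *
    unfold up at h3
    split_ifs at h3 <;> omega
  into v hv u hu := by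
    have h1 := hs v u hu
    have h2 := hB u
    simp only [Set.mem_ofPred_eq] at *
    exact ⟨hsymm _ _ hu, by omega⟩
  adj_of' u v h := h.1
  sink u v h hu := by
    have h2 := hB v
    have h3 := h.2
    simp only [Set.mem_ofPred_eq] at *
    omega
  same u v hu hv := by
    simp only [Set.mem_ofPred_eq] at *
    simp [arr, up, hu, hv]

end Slice

section Simple

variable {k ι : Type} [Field k]

variable (k) in
/-- The simple representation at a vertex. -/
noncomputable def simpleRep (v : ι) : TRep k ι where
  obj w := ↥(if w = v then ⊤ else ⊥ : Submodule k k)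
  map _ _ := 0

variable (k) in
/-- The generator of a simple representation. -/
noncomputable def simpleGen (v : ι) : (simpleRep k v).obj v :=
  (⟨1, by simp⟩ : ↥(if v = v then ⊤ else ⊥ : Submodule k k))

theorem simpleGen_ne_zero (v : ι) : simpleGen k v ≠ 0 :=
  fun h => one_ne_zero (congrArg Subtype.val h : (1 : k) = 0)

theorem simpleRep_eq_zero {v w : ι} (h : w ≠ v) (x : (simpleRep k v).obj w) : x = 0 := by
  obtain ⟨x, hx⟩ : ↥(if w = v then ⊤ else ⊥ : Submodule k k) := x
  rw [if_neg h] at hx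
  exact Subtype.ext hx

theorem exists_smul_simpleGen (v : ι) (x : (simpleRep k v).obj v) :
    ∃ c : k, x = c • simpleGen k v := by
  obtain ⟨x, hx⟩ : ↥(if v = v then ⊤ else ⊥ : Submodule k k) := x
  exact ⟨x, Subtype.ext (mul_one x).symm⟩

theorem dim_simpleRep (v : ι) : (simpleRep k v).dim = delta v := by
  funext w
  by_cases h : w = v
  · subst h
    have : Module.finrank k ((simpleRep k w).obj w) = 1 :=
      finrank_eq_one (simpleGen k w) (simpleGen_ne_zero w) fun x =>
        (exists_smul_simpleGen w x).imp fun c hc => hc.symm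
    simp [TRep.dim, this, delta]
  · have : Module.finrank k ((simpleRep k v).obj w) = 0 := by
      have : Subsingleton ((simpleRep k v).obj w) :=
        ⟨fun a b => (simpleRep_eq_zero h a).trans (simpleRep_eq_zero h b).symm⟩
      exact Module.finrank_zero_of_subsingleton
    simp [TRep.dim, this, delta, h]

theorem indecRep_simpleRep (r : ι → ι → Prop) (v : ι) : IndecRep r (simpleRep k v) := by
  refine ⟨⟨v, _, simpleGen_ne_zero v⟩, fun f _ hff => ?_⟩
  obtain ⟨c, hc⟩ := exists_smul_simpleGen v (f v (simpleGen k v))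
  have h1 := LinearMap.congr_fun (congrFun hff v) (simpleGen k v)
  simp only [LinearMap.comp_apply, hc, map_smul] at h1
  rw [← sub_eq_zero, ← smul_sub, smul_eq_zero] at h1
  have ext' : ∀ g : (simpleRep k v).Fam (simpleRep k v),
      f v (simpleGen k v) = g v (simpleGen k v) → f = g := by
    intro g hg
    funext w
    ext x
    by_cases h : w = v
    · subst h
      obtain ⟨d, rfl⟩ := exists_smul_simpleGen w x
      rw [map_smul, map_smul, hg]
    · rw [simpleRep_eq_zero h x, map_zero, map_zero]
  rcases h1 with rfl | h1
  · exact Or.inl (ext' 0 (by simp [hc]))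
  · exact Or.inr (ext' _ (by simp [hc, sub_eq_zero.1 h1]))

/-- The map from a simple representation determined by the image of the generator. -/
noncomputable def simpleFam {v : ι} {M : TRep k ι} (x : M.obj v) : (simpleRep k v).Fam M :=
  Function.update 0 v ((LinearMap.toSpanSingleton k (M.obj v) x) ∘ₗ
    (Submodule.subtype (if v = v then ⊤ else ⊥ : Submodule k k)))

theorem simpleFam_gen {v : ι} {M : TRep k ι} (x : M.obj v) :
    simpleFam x v (simpleGen k v) = x := by
  rw [simpleFam, Function.update_self]
  exact one_smul k x

theorem isHom_simpleFam {r : ι → ι → Prop} {v : ι} {M : TRep k ι} (x : M.obj v)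
    (hv : ∀ u, ¬ r v u) : IsHom r (simpleRep k v) M (simpleFam x) := by
  intro u w huw y
  have huv : u ≠ v := by
    rintro rfl
    exact hv _ huw
  rw [simpleRep_eq_zero huv y]
  simp

end Simple

section Lower

variable {k ι : Type} [Field k] [Fintype ι] {adj : ι → ι → Prop}

/-- Iterated reflections of a representation. -/
noncomputable def grow (adj : ι → ι → Prop) : ℕ → (ι → ℤ) → ℤ → TRep k ι → TRep k ι
  | 0, _, _, M => M
  | n + 1, τ, B, M => refl adj {v | τ v = B} (grow adj n (up τ B) (B + 1) M)

/-- The vertex has minimal height after `n` steps of raising. -/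
def Low : ℕ → (ι → ℤ) → ℤ → ι → Prop
  | 0, τ, B, v => τ v = B
  | n + 1, τ, B, v => Low n (up τ B) (B + 1) v

theorem low_of_parity {n : ℕ} {τ : ι → ℤ} {B : ℤ} {v : ι} (h1 : B ≤ τ v) (h2 : τ v ≤ B + n)
    (h3 : τ v % 2 = (B + n) % 2) : Low n τ B v := by
  induction n generalizing τ B with
  | zero => simp only [Low]; push_cast at h2; omega
  | succ n ih =>
    push_cast at h2 h3
    by_cases h : τ v = B
    · refine ih ?_ ?_ ?_ <;> simp only [up, if_pos h] <;> omega
    · refine ih ?_ ?_ ?_ <;> simp only [up, if_neg h] <;> omega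

variable (k) in
/-- The representations which appear in the chains below. -/
def Grown (adj : ι → ι → Prop) (n : ℕ) (τ : ι → ℤ) (B : ℤ) (M : TRep k ι) : Prop :=
  ∃ j ≤ n, ∃ v, Low j τ B v ∧ M = grow adj j τ B (simpleRep k v)

theorem Grown.refl {n : ℕ} {τ : ι → ℤ} {B : ℤ} {M : TRep k ι}
    (hM : Grown k adj n (up τ B) (B + 1) M) :
    Grown k adj (n + 1) τ B (refl adj {v | τ v = B} M) := by
  obtain ⟨j, hj, v, hv, rfl⟩ := hM
  exact ⟨j + 1, by omega, v, hv, rfl⟩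

variable {h : ℕ} {star : ι → ι}

/-- The formula for the dimension of `grow`. -/
theorem CoxeterData.grow_step (D : CoxeterData adj h star) {n : ℕ} (hn : n + 2 ≤ h) {τ : ι → ℤ} {B : ℤ} (hs : IsSlice adj τ)
    (hB : ∀ v, B ≤ τ v) {v : ι} {N : TRep k ι} (hN : IndecRep (arr adj (up τ B)) N)
    (hd : ∀ w, N.dim w = if up τ B w ≤ B + 1 + n then
      addSeq adj 0 (delta v) (B + 1 + n - up τ B w + 1).toNat w else 0) :
    InjAt adj {v | τ v = B} N ∧
    IndecRep (arr adj τ) (refl adj {v | τ v = B} N) ∧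
    ∀ w, (refl adj {v | τ v = B} N).dim w = if τ w ≤ B + (n + 1 : ℕ) then
      addSeq adj 0 (delta v) (B + (n + 1 : ℕ) - τ w + 1).toNat w else 0 := by
  have R := reflPair_up D.symm hs hB
  have hd0 : ∀ i, τ i = B → N.dim i = addSeq adj 0 (delta v) n i := by
    intro i hi
    rw [hd i, up, if_pos hi]
    split_ifs with h1
    · rw [show (B + 1 + n - (B + 2) + 1).toNat = n by omega]
    · obtain rfl : n = 0 := by omega
      rfl
  have hd1 : ∀ i, τ i = B → ∀ u, adj i u → N.dim u = addSeq adj 0 (delta v) (n + 1) u := by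
    intro i hi u hu
    have h1 := hs i u hu
    have h2 := hB u
    rw [hd u, up, if_neg (show ¬ τ u = B by omega),
      if_pos (show τ u ≤ B + 1 + n by omega), show (B + 1 + n - τ u + 1).toNat = n + 1 by omega]
  have hdn : ∀ i, τ i = B → nbSum adj N.dim i - N.dim i = addSeq adj 0 (delta v) (n + 2) i := by
    intro i hi
    show _ = nbSum adj (addSeq adj 0 (delta v) (n + 1)) i - addSeq adj 0 (delta v) n i
    rw [hd0 i hi]
    congr 1
    exact Finset.sum_congr rfl fun u _ => hd1 i hi u u.2
  have hI : InjAt adj {v | τ v = B} N := by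
    by_contra hI
    simp only [InjAt] at hI
    push Not at hI
    obtain ⟨i, hi, x, hx, hx0⟩ := hI
    obtain ⟨hw, -⟩ := hN.simple_of_source (fun u hu => R.source u i hu hi) hx0
      fun u hu => hx u hu.1
    have h1 := D.nonneg v i (n + 2) hn
    have h2 : nbSum adj N.dim i = 0 := Finset.sum_eq_zero fun u _ => by
      have hui : (u : ι) ≠ i := by
        intro hui
        have h3 := hs i u u.2
        rw [hui] at h3
        omega
      have : Subsingleton (N.obj u) := ⟨fun a b => (hw u hui a).trans (hw u hui b).symm⟩
      simp only [TRep.dim]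
      exact_mod_cast Module.finrank_zero_of_subsingleton
    rw [← hdn i hi, h2] at h1
    exact hx0 (TRep.eq_zero_of_dim (by omega) x)
  refine ⟨hI, R.indec hI hN, fun w => ?_⟩
  by_cases hw : τ w = B
  · have h1 : (refl adj {v | τ v = B} N).dim w = nbSum adj N.dim w - N.dim w :=
      finrank_refl_of_mem N hI hw
    rw [h1, hdn w hw, if_pos (by push_cast; omega)]
    congr 1
    push_cast
    omega
  · have h1 : (refl adj {v | τ v = B} N).dim w = N.dim w :=
      congrArg Nat.cast (finrank_refl_of_notMem N hw)
    rw [h1, hd w, up, if_neg hw]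
    push_cast
    rw [show B + 1 + (n : ℤ) = B + (n + 1) by ring]

theorem CoxeterData.grow_simple (D : CoxeterData adj h star) {n : ℕ} (hn : n + 1 ≤ h) {τ : ι → ℤ} {B : ℤ} (hs : IsSlice adj τ)
    (hB : ∀ v, B ≤ τ v) {v : ι} (hv : Low n τ B v) :
    IndecRep (arr adj τ) (grow adj n τ B (simpleRep k v)) ∧
    ∀ w, (grow adj n τ B (simpleRep k v)).dim w = if τ w ≤ B + n then
      addSeq adj 0 (delta v) (B + n - τ w + 1).toNat w else 0 := by
  induction n generalizing τ B with
  | zero =>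
    refine ⟨indecRep_simpleRep _ v, fun w => ?_⟩
    rw [grow, dim_simpleRep]
    have h1 := hB w
    have h2 : τ v = B := hv
    split_ifs with h3
    · rw [show (B + (0 : ℕ) - τ w + 1).toNat = 1 by omega]
      rfl
    · rw [delta, if_neg]
      rintro rfl
      omega
  | succ n ih =>
    obtain ⟨h1, h2⟩ := ih (by omega) (hs.up hB) (le_up hB) hv
    exact (D.grow_step hn hs hB h1 h2).2

theorem CoxeterData.grown_indec (D : CoxeterData adj h star) {n : ℕ} (hn : n + 1 ≤ h) {τ : ι → ℤ} {B : ℤ} (hs : IsSlice adj τ)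
    (hB : ∀ v, B ≤ τ v) {M : TRep k ι} (hM : Grown k adj n τ B M) : IndecRep (arr adj τ) M := by
  obtain ⟨j, hj, v, hv, rfl⟩ := hM
  exact (D.grow_simple (by omega) hs hB hv).1

theorem CoxeterData.grown_injAt (D : CoxeterData adj h star) {n : ℕ} (hn : n + 2 ≤ h) {τ : ι → ℤ} {B : ℤ} (hs : IsSlice adj τ)
    (hB : ∀ v, B ≤ τ v) {M : TRep k ι} (hM : Grown k adj n (up τ B) (B + 1) M) :
    InjAt adj {v | τ v = B} M := by
  obtain ⟨j, hj, v, hv, rfl⟩ := hM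
  obtain ⟨h1, h2⟩ := D.grow_simple (k := k) (by omega) (hs.up hB) (le_up hB) hv
  exact (D.grow_step (by omega) hs hB h1 h2).1

theorem CoxeterData.refl_chain (D : CoxeterData adj h star) {n l : ℕ} (hn : n + 2 ≤ h) {τ : ι → ℤ} {B : ℤ} (hs : IsSlice adj τ)
    (hB : ∀ v, B ≤ τ v) {M N : TRep k ι} {f : M.Fam N}
    (hf : NChain (arr adj (up τ B)) (Grown k adj n (up τ B) (B + 1)) l M N f) :
    NChain (arr adj τ) (Grown k adj (n + 1) τ B) l (refl adj {v | τ v = B} M)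
      (refl adj {v | τ v = B} N) (reflFam adj {v | τ v = B} f) := by
  have R := reflPair_up D.symm hs hB
  induction hf with
  | nil M hM =>
    rw [R.reflFam_id]
    exact .nil _ hM.refl
  | cons hM hf hb hg ih =>
    rw [R.reflFam_comp hg.isHom hf]
    exact .cons hM.refl (R.isHom hf) (fun h => hb (R.famBij (D.grown_injAt hn hs hB hM)
      (D.grown_injAt hn hs hB hg.source) hf h)) ih

theorem CoxeterData.exists_chain_of_ne_zero (D : CoxeterData adj h star) {n : ℕ} (hn : n + 1 ≤ h) {τ : ι → ℤ} {B : ℤ}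
    (hs : IsSlice adj τ) (hB : ∀ v, B ≤ τ v) {i : ι} (hi : τ i = B) (N : TRep k ι)
    (x : (grow adj n τ B N).obj i) (φ : (grow adj n τ B N).obj i →ₗ[k] k) (hx : φ x ≠ 0) :
    ∃ (Z : TRep k ι) (c : (simpleRep k i).Fam Z) (g : Z.Fam (grow adj n τ B N)),
      NChain (arr adj τ) (Grown k adj n τ B) n (simpleRep k i) Z c ∧
      IsHom (arr adj τ) Z (grow adj n τ B N) g ∧ φ (g i (c i (simpleGen k i))) ≠ 0 := by
  have hsink : ∀ {τ : ι → ℤ} {B : ℤ} {i : ι}, (∀ v, B ≤ τ v) → τ i = B →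
      ∀ u, ¬ arr adj τ i u := fun hB hi u hu => by
    have h1 := hB u
    have h2 := hu.2
    omega
  induction n generalizing τ B i with
  | zero =>
    refine ⟨simpleRep k i, _, simpleFam x, .nil _ ⟨0, le_rfl, i, hi, rfl⟩,
      isHom_simpleFam x (hsink hB hi), ?_⟩
    simpa [simpleFam_gen] using hx
  | succ n ih =>
    have R := reflPair_up D.symm hs hB
    have hiI : i ∈ {v | τ v = B} := hi
    obtain ⟨w, hw⟩ := proj_surjective (adj := adj) (grow adj n (up τ B) (B + 1) N) hiI x
    rw [proj_eq_sum _ (R.nbr i hiI) hiI] at hw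
    have hsum := map_sum (M := (refl adj {v | τ v = B} (grow adj n (up τ B) (B + 1) N)).obj i) φ
      (fun u : {u // adj i u} => (refl adj {v | τ v = B} (grow adj n (up τ B) (B + 1) N)).map u i
        (inc adj {v | τ v = B} (grow adj n (up τ B) (B + 1) N) u (w u))) Finset.univ
    obtain ⟨⟨u, hu⟩, -, hux⟩ :=
      Finset.exists_ne_zero_of_sum_ne_zero (fun h0 => hx (hw ▸ hsum.trans h0))
    have hτ : up τ B u = B + 1 := by
      have h1 := hs i u hu
      have h2 := hB u
      rw [up, if_neg (by omega)]
      omega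
    obtain ⟨Z, c, g, hc, hg, hgc⟩ := ih (by omega) (hs.up hB) (le_up hB) hτ _
      (φ ∘ₗ (refl adj {v | τ v = B} _).map u i ∘ₗ inc adj {v | τ v = B} _ u) hux
    have hne : u ≠ i := by
      rintro rfl
      have := hs _ _ hu
      omega
    have hf := isHom_simpleFam ((refl adj {v | τ v = B} (simpleRep k u)).map u i
      (inc adj {v | τ v = B} _ u (simpleGen k u))) (hsink hB hi)
    have hc' := D.refl_chain (by omega) hs hB hc
    refine ⟨_, _, _, .cons ⟨0, by omega, i, hi, rfl⟩ hf (fun hbij => ?_) hc', R.isHom hg, ?_⟩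
    · obtain ⟨y, hy⟩ := (hbij u).2 (inc adj {v | τ v = B} _ u (simpleGen k u))
      rw [simpleRep_eq_zero hne y, map_zero] at hy
      exact simpleGen_ne_zero u ((inc_bijective _ (R.nbr i hiI u hu)).1
        (hy.symm.trans (map_zero _).symm))
    · have harr := R.into i hiI u hu
      have hval := R.isHom hg u i harr (reflFam adj {v | τ v = B} c u
        (inc adj {v | τ v = B} _ u (simpleGen k u)))
      rw [← hc'.isHom u i harr, reflFam_inc R hc.isHom, reflFam_inc R hg] at hval
      rw [LinearMap.comp_apply, simpleFam_gen]
      exact fun h0 => hgc ((congrArg φ hval).symm.trans h0)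

theorem CoxeterData.exists_chain (D : CoxeterData adj h star) {ξ : ι → ℤ} (hs : IsSlice adj ξ) {i : ι}
    (hi : ∀ v, ξ i ≤ ξ v) :
    ∃ (M N : TRep k ι) (c : M.Fam N),
      NChain (arr adj ξ) (IndecRep (arr adj ξ)) (h - 2) M N c ∧ c ≠ 0 := by
  have h2 := D.two_le
  have hev := D.even
  have hlow : Low (h - 2) ξ (ξ i) (star i) := by
    have h1 := D.spread ξ hs i (star i)
    have h3 := D.spread ξ hs (star i) i
    have h4 := D.parity ξ hs i
    exact low_of_parity (hi _) (by omega) (by omega)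
  have hd := (D.grow_simple (k := k) (by omega) hs hi hlow).2 i
  rw [if_pos (by omega), show (ξ i + (h - 2 : ℕ) - ξ i + 1).toNat = h - 1 by omega, D.last,
    D.star_star, delta, if_pos rfl] at hd
  obtain ⟨x, hx⟩ : ∃ x : (grow adj (h - 2) ξ (ξ i) (simpleRep k (star i))).obj i, x ≠ 0 := by
    by_contra! hall
    have : Subsingleton ((grow adj (h - 2) ξ (ξ i) (simpleRep k (star i))).obj i) :=
      ⟨fun a b => (hall a).trans (hall b).symm⟩
    simp [TRep.dim, Module.finrank_zero_of_subsingleton] at hd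
  obtain ⟨φ, hφ⟩ := Module.Projective.exists_dual_ne_zero k hx
  obtain ⟨Z, c, g, hc, hg, hgc⟩ := D.exists_chain_of_ne_zero (by omega) hs hi rfl _ x φ hφ
  refine ⟨_, Z, c, hc.mono fun M hM => D.grown_indec (by omega) hs hi hM, ?_⟩
  rintro rfl
  simp at hgc

end Lower

/-- A complete family of orthogonal idempotents of an algebra, together with elements attached to
the arrows of a quiver. -/
structure PathFamily {A ι : Type} [Ring A] [Fintype ι] (e : ι → A) (x : ι → ι → A) : Prop where
  idem : ∀ v, e v * e v = e v
  orth : ∀ u v, u ≠ v → e u * e v = 0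
  sum : ∑ v, e v = 1
  mem_left : ∀ u v, e v * x u v = x u v
  mem_right : ∀ u v, x u v * e u = x u v

section ToRep

open scoped ModuleCat

variable {k A ι : Type} [Field k] [Ring A] [Algebra k A] [FiniteDimensional k A] [Fintype ι]
  {e : ι → A} {x : ι → ι → A}

/-- The part of a module which is supported at a vertex. -/
def vtx (k : Type) [Field k] [Algebra k A] (e : ι → A) (M : ModuleCat.{0} A) (v : ι) :
    Submodule k M where
  carrier := {m | e v • m = m}
  add_mem' ha hb := by
    simp only [Set.mem_ofPred_eq] at *
    rw [smul_add, ha, hb]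
  zero_mem' := smul_zero _
  smul_mem' c m hm := by
    simp only [Set.mem_ofPred_eq] at *
    rw [smul_comm, hm]

theorem finite_of_finite_module (M : ModuleCat.{0} A) [Module.Finite A M] : Module.Finite k M :=
  Module.Finite.trans A M

/-- The representation attached to a module. -/
noncomputable def toRep (k : Type) [Field k] [Algebra k A] [FiniteDimensional k A]
    (hP : PathFamily e x) (M : ModuleCat.{0} A) [Module.Finite A M] : TRep k ι where
  obj v := vtx k e M v
  fin v := by
    have := finite_of_finite_module (k := k) M
    infer_instance
  map u v := LinearMap.codRestrict _
    (Algebra.lsmul k k M (x u v) ∘ₗ (vtx k e M u).subtype) fun m => by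
      show e v • x u v • (m : M) = x u v • (m : M)
      rw [smul_smul, hP.mem_left]


variable (hP : PathFamily e x)

/-- The element of the module underlying a vector of the associated representation. -/
noncomputable def elt {M : ModuleCat.{0} A} [Module.Finite A M] {v : ι} :
    (toRep k hP M).obj v →ₗ[k] M :=
  (vtx k e M v).subtype

variable {hP} in
theorem elt_injective {M : ModuleCat.{0} A} [Module.Finite A M] {v : ι}
    {m n : (toRep k hP M).obj v} (h : elt hP m = elt hP n) : m = n := Subtype.ext h

theorem idem_smul_elt {M : ModuleCat.{0} A} [Module.Finite A M] {v : ι}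
    (m : (toRep k hP M).obj v) : e v • elt hP m = elt hP m :=
  Subtype.property (p := (· ∈ vtx k e M v)) m

theorem elt_map {M : ModuleCat.{0} A} [Module.Finite A M] (u v : ι)
    (m : (toRep k hP M).obj u) : elt hP ((toRep k hP M).map u v m) = x u v • elt hP m := rfl

/-- The component of an element at a vertex. -/
noncomputable def comp (M : ModuleCat.{0} A) [Module.Finite A M] (v : ι) (m : M) :
    (toRep k hP M).obj v :=
  (⟨e v • m, by
    show e v • e v • m = e v • m
    rw [smul_smul, hP.idem]⟩ : vtx k e M v)

theorem elt_comp (M : ModuleCat.{0} A) [Module.Finite A M] (v : ι) (m : M) :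
    elt hP (comp (k := k) hP M v m) = e v • m := rfl

theorem comp_add (M : ModuleCat.{0} A) [Module.Finite A M] (v : ι) (m n : M) :
    comp (k := k) hP M v (m + n) = comp hP M v m + comp hP M v n :=
  elt_injective (smul_add _ _ _)

theorem comp_smul (M : ModuleCat.{0} A) [Module.Finite A M] (v : ι) (c : k) (m : M) :
    comp (k := k) hP M v (c • m) = c • comp hP M v m :=
  elt_injective (smul_comm _ _ _)

theorem comp_elt (M : ModuleCat.{0} A) [Module.Finite A M] (v : ι)
    (m : (toRep k hP M).obj v) : comp hP M v (elt hP m) = m :=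
  elt_injective (idem_smul_elt hP m)

theorem comp_elt_of_ne (M : ModuleCat.{0} A) [Module.Finite A M] {v w : ι} (h : w ≠ v)
    (m : (toRep k hP M).obj v) : comp (k := k) hP M w (elt hP m) = 0 :=
  elt_injective (by
    rw [elt_comp, ← idem_smul_elt, smul_smul, hP.orth w v h, zero_smul, map_zero])

theorem sum_comp (M : ModuleCat.{0} A) [Module.Finite A M] (m : M) :
    ∑ v, elt hP (comp (k := k) hP M v m) = m := by
  simp only [elt_comp]
  rw [← Finset.sum_smul, hP.sum, one_smul]

/-- The homomorphism of representations attached to a module homomorphism. -/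
noncomputable def toRepMap {M N : ModuleCat.{0} A} [Module.Finite A M] [Module.Finite A N]
    (f : M ⟶ N) : (toRep k hP M).Fam (toRep k hP N) := fun v =>
  LinearMap.restrict (p := vtx k e M v) (q := vtx k e N v) (f.hom.restrictScalars k)
    fun m (hm : e v • m = m) => by
      show e v • f.hom m = f.hom m
      rw [← map_smul, hm]

theorem isHom_toRepMap (r : ι → ι → Prop) {M N : ModuleCat.{0} A} [Module.Finite A M]
    [Module.Finite A N] (f : M ⟶ N) : IsHom r _ _ (toRepMap (k := k) hP f) := fun u v _ m =>
  elt_injective (map_smul f.hom (x u v) (elt hP m))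

theorem toRepMap_id (M : ModuleCat.{0} A) [Module.Finite A M] :
    toRepMap (k := k) hP (𝟙 M) = (toRep k hP M).idFam := rfl

theorem toRepMap_zero (M N : ModuleCat.{0} A) [Module.Finite A M] [Module.Finite A N] :
    toRepMap (k := k) hP (0 : M ⟶ N) = 0 := rfl

theorem toRepMap_comp {M N X : ModuleCat.{0} A} [Module.Finite A M] [Module.Finite A N]
    [Module.Finite A X] (f : M ⟶ N) (g : N ⟶ X) :
    toRepMap (k := k) hP (f ≫ g) = (toRepMap hP g).comp (toRepMap hP f) := rfl

theorem toRepMap_injective {M N : ModuleCat.{0} A} [Module.Finite A M] [Module.Finite A N]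
    {f g : M ⟶ N} (h : toRepMap (k := k) hP f = toRepMap hP g) : f = g := by
  ext m
  rw [← sum_comp (k := k) hP M m, map_sum, map_sum]
  exact Finset.sum_congr rfl fun v _ => congrArg (elt hP) (LinearMap.congr_fun (congrFun h v) _)

theorem toRepMap_surjective {r : ι → ι → Prop}
    (hgen : Algebra.adjoin k (Set.range e ∪ {a | ∃ u v, r u v ∧ x u v = a}) = ⊤)
    {M N : ModuleCat.{0} A} [Module.Finite A M] [Module.Finite A N]
    {g : (toRep k hP M).Fam (toRep k hP N)} (hg : IsHom r _ _ g) :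
    ∃ f : M ⟶ N, toRepMap hP f = g := by
  let F : M → N := fun m => ∑ v, elt hP (g v (comp hP M v m))
  have hadd : ∀ m n, F (m + n) = F m + F n := fun m n => by
    simp only [F, comp_add, map_add, ← Finset.sum_add_distrib]
  have helt : ∀ v (m : (toRep k hP M).obj v), F (elt hP m) = elt hP (g v m) := by
    intro v m
    refine (Finset.sum_eq_single v (fun w _ hw => ?_) (by simp)).trans ?_
    · rw [comp_elt_of_ne hP M hw, map_zero, map_zero]
    · rw [comp_elt]
  have hk : ∀ (c : k) m, F (c • m) = c • F m := fun c m => by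
    simp only [F, comp_smul, map_smul, Finset.smul_sum]
  have hFcomp : ∀ v m, e v • F m = F (e v • m) := by
    intro v m
    rw [← elt_comp (k := k) hP M v m, helt, Finset.smul_sum]
    refine (Finset.sum_eq_single v (fun w _ hw => ?_) (by simp)).trans ?_
    · rw [← idem_smul_elt, smul_smul, hP.orth v w (Ne.symm hw), zero_smul]
    · exact idem_smul_elt hP _
  have hsmul : ∀ (a : A) m, F (a • m) = a • F m := by
    intro a
    have ha : a ∈ Algebra.adjoin k (Set.range e ∪ {a | ∃ u v, r u v ∧ x u v = a}) := by
      rw [hgen]; trivial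
    induction ha using Algebra.adjoin_induction with
    | mem a ha =>
      intro m
      obtain ⟨v, rfl⟩ | ⟨u, v, huv, rfl⟩ := ha
      · exact (hFcomp v m).symm
      · have h2 : x u v • m = elt hP ((toRep k hP M).map u v (comp hP M u m)) := by
          rw [elt_map, elt_comp, smul_smul, hP.mem_right]
        have h3 : x u v • F m = x u v • F (e u • m) := by
          rw [← hFcomp, smul_smul, hP.mem_right]
        rw [h3, h2, helt, hg u v huv, elt_map, ← elt_comp (k := k) hP M u m, helt]
    | algebraMap c =>
      intro m
      rw [algebraMap_smul, algebraMap_smul]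
      exact hk c m
    | add a b _ _ ha hb =>
      intro m
      rw [add_smul, add_smul, hadd, ha, hb]
    | mul a b _ _ ha hb =>
      intro m
      rw [mul_smul, mul_smul, ha, hb]
  refine ⟨ModuleCat.ofHom ⟨⟨F, hadd⟩, hsmul⟩, ?_⟩
  funext v
  ext m
  exact elt_injective (helt v m)

variable {r : ι → ι → Prop}

theorem isIso_iff_famBij
    (hgen : Algebra.adjoin k (Set.range e ∪ {a | ∃ u v, r u v ∧ x u v = a}) = ⊤)
    {M N : ModuleCat.{0} A} [Module.Finite A M] [Module.Finite A N] (f : M ⟶ N) :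
    IsIso f ↔ FamBij (toRepMap (k := k) hP f) := by
  constructor
  · intro hf
    refine famBij_of_inverse (g := toRepMap hP (inv f)) ?_ ?_
    · rw [← toRepMap_comp, IsIso.hom_inv_id, toRepMap_id]
    · rw [← toRepMap_comp, IsIso.inv_hom_id, toRepMap_id]
  · intro hf
    obtain ⟨g, hg, h1, h2⟩ := hf.exists_inverse (isHom_toRepMap hP r f)
    obtain ⟨g, rfl⟩ := toRepMap_surjective hP hgen hg
    exact ⟨g, toRepMap_injective (k := k) hP h1, toRepMap_injective (k := k) hP h2⟩

theorem indec_iff_indecRep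
    (hgen : Algebra.adjoin k (Set.range e ∪ {a | ∃ u v, r u v ∧ x u v = a}) = ⊤)
    (M : ModuleCat.{0} A) [Module.Finite A M] : Indec A M ↔ IndecRep r (toRep k hP M) := by
  refine and_congr ?_ ?_
  · constructor
    · intro h
      obtain ⟨m, hm⟩ := exists_ne (0 : M)
      by_contra! hall
      refine hm ?_
      rw [← sum_comp (k := k) hP M m]
      exact Finset.sum_eq_zero fun v _ => (congrArg (elt hP) (hall v (comp hP M v m))).trans
        (map_zero _)
    · rintro ⟨v, m, hm⟩
      exact ⟨elt hP m, 0, fun h => hm (elt_injective (h.trans (map_zero _).symm))⟩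
  · constructor
    · intro h f hf hff
      obtain ⟨f, rfl⟩ := toRepMap_surjective hP hgen hf
      rcases h f (toRepMap_injective (k := k) hP hff) with rfl | rfl
      · exact Or.inl (toRepMap_zero hP M M)
      · exact Or.inr (toRepMap_id hP M)
    · intro h f hff
      rcases h _ (isHom_toRepMap hP r f) (congrArg (toRepMap (k := k) hP) hff) with h0 | h0
      · exact Or.inl (toRepMap_injective (k := k) hP h0)
      · exact Or.inr (toRepMap_injective (k := k) hP h0)

end ToRep

/-- A distance function on the vertices of a tree. -/
structure TreeDist {ι : Type} (adj : ι → ι → Prop) (d : ι → ι → ℕ) : Prop where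
  self : ∀ u, d u u = 0
  step : ∀ u a v, adj a v → d u v = d u a + 1 ∨ d u a = d u v + 1
  unique : ∀ u a b v, adj a v → adj b v → d u v = d u a + 1 → d u v = d u b + 1 → a = b

/-- Products of elements attached to the arrows of a quiver along its paths. -/
inductive PathProd {C ι : Type} [Mul C] (r : ι → ι → Prop) (e : ι → C) (x : ι → ι → C) :
    ι → ι → C → Prop
  | nil (u : ι) : PathProd r e x u u (e u)
  | cons {u v w : ι} {y : C} (hy : PathProd r e x u v y) (h : r v w) :
      PathProd r e x u w (x v w * y)

section Paths

variable {C ι : Type} {adj : ι → ι → Prop} {ξ : ι → ℤ} {d : ι → ι → ℕ}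

theorem PathProd.last [Mul C] {e : ι → C} {x : ι → ι → C} (hd : TreeDist adj d)
    (hsymm : ∀ u v, adj u v → adj v u) {u v : ι} {y : C}
    (hy : PathProd (arr adj ξ) e x u v y) :
    v = u ∧ y = e u ∨ ∃ w y', arr adj ξ w v ∧ d u v = d u w + 1 ∧
      PathProd (arr adj ξ) e x u w y' ∧ y = x w v * y' := by
  induction hy with
  | nil => exact Or.inl ⟨rfl, rfl⟩
  | @cons a v y hy h ih =>
    refine Or.inr ⟨a, y, h, ?_, hy, rfl⟩
    rcases hd.step u a v h.1 with h1 | h1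
    · exact h1
    · rcases ih with ⟨rfl, -⟩ | ⟨w, -, hw, hdw, -⟩
      · rw [hd.self] at h1
        omega
      · obtain rfl := hd.unique u w v a hw.1 (hsymm _ _ h.1) hdw h1
        have h2 := hw.2
        have h3 := h.2
        omega

theorem PathProd.unique [Mul C] {e : ι → C} {x : ι → ι → C} (hd : TreeDist adj d)
    (hsymm : ∀ u v, adj u v → adj v u) {u : ι} (n : ℕ) : ∀ {v : ι} {y y' : C}, d u v = n →
    PathProd (arr adj ξ) e x u v y → PathProd (arr adj ξ) e x u v y' → y = y' := by
  induction n with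
  | zero =>
    intro v y y' h hy hy'
    rcases hy.last hd hsymm with ⟨rfl, rfl⟩ | ⟨w, z, -, h1, -⟩
    · rcases hy'.last hd hsymm with ⟨-, rfl⟩ | ⟨w, z, -, h1, -⟩
      · rfl
      · omega
    · omega
  | succ n ih =>
    intro v y y' h hy hy'
    rcases hy.last hd hsymm with ⟨rfl, -⟩ | ⟨w, z, hw, h1, hz, rfl⟩
    · rw [hd.self] at h
      omega
    rcases hy'.last hd hsymm with ⟨rfl, -⟩ | ⟨w', z', hw', h1', hz', rfl⟩
    · rw [hd.self] at h
      omega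
    obtain rfl := hd.unique u w w' v hw.1 hw'.1 h1 h1'
    rw [ih (by omega) hz hz']

variable [Ring C] [Fintype ι] {k : Type} [Field k] [Algebra k C] {e : ι → C} {x : ι → ι → C}
  {r : ι → ι → Prop}

theorem PathFamily.idem_mul_pathProd (hP : PathFamily e x) {u v : ι} {y : C}
    (hy : PathProd r e x u v y) : e v * y = y := by
  cases hy with
  | nil => exact hP.idem u
  | cons hy h => rw [← mul_assoc, hP.mem_left]

theorem PathFamily.idem_mul_pathProd_of_ne (hP : PathFamily e x) {u v w : ι} (hw : w ≠ v) {y : C}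
    (hy : PathProd r e x u v y) : e w * y = 0 := by
  rw [← hP.idem_mul_pathProd hy, ← mul_assoc, hP.orth w v hw, zero_mul]

theorem PathFamily.mul_mem_span (hP : PathFamily e x) {b : C}
    (hb : b ∈ Algebra.adjoin k (Set.range e ∪ {a | ∃ u v, r u v ∧ x u v = a})) (u : ι) :
    ∀ s ∈ Submodule.span k {y | ∃ v, PathProd r e x u v y},
      b * s ∈ Submodule.span k {y | ∃ v, PathProd r e x u v y} := by
  induction hb using Algebra.adjoin_induction with
  | mem b hb =>
    intro s hs
    induction hs using Submodule.span_induction with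
    | mem y hy =>
      obtain ⟨v, hy⟩ := hy
      obtain ⟨w, rfl⟩ | ⟨w, w', hw, rfl⟩ := hb
      · by_cases h : w = v
        · subst h
          rw [hP.idem_mul_pathProd hy]
          exact Submodule.subset_span ⟨w, hy⟩
        · rw [hP.idem_mul_pathProd_of_ne h hy]
          exact zero_mem _
      · by_cases h : w = v
        · subst h
          exact Submodule.subset_span ⟨w', hy.cons hw⟩
        · rw [← hP.mem_right, mul_assoc, hP.idem_mul_pathProd_of_ne h hy, mul_zero]
          exact zero_mem _
    | zero => rw [mul_zero]; exact zero_mem _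
    | add y z _ _ hy hz => rw [mul_add]; exact add_mem hy hz
    | smul c y _ hy => rw [mul_smul_comm]; exact Submodule.smul_mem _ _ hy
  | algebraMap c =>
    intro s hs
    rw [← Algebra.smul_def]
    exact Submodule.smul_mem _ _ hs
  | add a b _ _ ha hb =>
    intro s hs
    rw [add_mul]
    exact add_mem (ha s hs) (hb s hs)
  | mul a b _ _ ha hb =>
    intro s hs
    rw [mul_assoc]
    exact ha _ (hb s hs)

theorem PathFamily.idem_mul_mem_span (hP : PathFamily e x) {u : ι} (v : ι) {s : C}
    (hs : s ∈ Submodule.span k {y | ∃ v, PathProd r e x u v y}) :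
    e v * s ∈ Submodule.span k {y | PathProd r e x u v y} := by
  induction hs using Submodule.span_induction with
  | mem y hy =>
    obtain ⟨w, hy⟩ := hy
    by_cases h : v = w
    · subst h
      rw [hP.idem_mul_pathProd hy]
      exact Submodule.subset_span hy
    · rw [hP.idem_mul_pathProd_of_ne h hy]
      exact zero_mem _
  | zero => rw [mul_zero]; exact zero_mem _
  | add y z _ _ hy hz => rw [mul_add]; exact add_mem hy hz
  | smul c y _ hy => rw [mul_smul_comm]; exact Submodule.smul_mem _ _ hy

/-- An algebra generated by a tree quiver maps injectively to any algebra in which the paths do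
not vanish. -/
theorem PathFamily.eq_zero_of_map (hP : PathFamily e x) (hd : TreeDist adj d)
    (hsymm : ∀ u v, adj u v → adj v u) (hr : r = arr adj ξ) {A : Type} [Ring A] [Algebra k A]
    (π : C →ₐ[k] A) (hπ : ∀ u v y, PathProd r e x u v y → π y ≠ 0) {b : C}
    (hb : b ∈ Algebra.adjoin k (Set.range e ∪ {a | ∃ u v, r u v ∧ x u v = a}))
    (hb0 : π b = 0) : b = 0 := by
  have key : ∀ u v, e v * (b * e u) = 0 := by
    intro u v
    have hmem := hP.idem_mul_mem_span v
      (hP.mul_mem_span hb u (e u) (Submodule.subset_span ⟨u, .nil u⟩))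
    have hπ0 : π (e v * (b * e u)) = 0 := by simp [hb0]
    by_cases hex : ∃ y, PathProd r e x u v y
    · obtain ⟨y, hy⟩ := hex
      have hset : {y | PathProd r e x u v y} = {y} := by
        ext z
        subst hr
        exact ⟨fun hz => PathProd.unique hd hsymm _ rfl hz hy, fun hz => hz ▸ hy⟩
      rw [hset] at hmem
      obtain ⟨c, hc⟩ := Submodule.mem_span_singleton.1 hmem
      rw [← hc, map_smul, smul_eq_zero] at hπ0
      rw [← hc, hπ0.resolve_right (hπ u v y hy), zero_smul]
    · have hset : {y | PathProd r e x u v y} = ∅ := by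
        ext z
        exact ⟨fun hz => hex ⟨z, hz⟩, fun hz => hz.elim⟩
      rwa [hset, Submodule.span_empty, Submodule.mem_bot] at hmem
  calc b = (∑ v, e v) * (b * ∑ u, e u) := by rw [hP.sum, mul_one, one_mul]
    _ = 0 := by
      rw [Finset.sum_mul]
      refine Finset.sum_eq_zero fun v _ => ?_
      rw [Finset.mul_sum, Finset.mul_sum]
      exact Finset.sum_eq_zero fun u _ => key u v

end Paths

section FromRep

variable {k A ι : Type} [Field k] [Ring A]
  {e : ι → A} {x : ι → ι → A} {adj : ι → ι → Prop} {ξ : ι → ℤ} {d : ι → ι → ℕ}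
  {r : ι → ι → Prop}

/-- The idempotents acting on the total space of a representation. -/
noncomputable def totalIdem (X : TRep k ι) (v : ι) : Module.End k (∀ v, X.obj v) :=
  LinearMap.single k X.obj v ∘ₗ LinearMap.proj v

/-- The arrows acting on the total space of a representation. -/
noncomputable def totalArrow (X : TRep k ι) (u v : ι) : Module.End k (∀ v, X.obj v) :=
  LinearMap.single k X.obj v ∘ₗ X.map u v ∘ₗ LinearMap.proj u

theorem pathFamily_total [Fintype ι] (hP : PathFamily e x) (X : TRep k ι) :
    PathFamily (fun v => (e v, totalIdem X v)) (fun u v => (x u v, totalArrow X u v)) where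
  idem v := Prod.ext (hP.idem v) (LinearMap.ext fun y => by simp [totalIdem])
  orth u v h := Prod.ext (hP.orth u v h) (LinearMap.ext fun y => by
    simp [totalIdem, Pi.single_eq_of_ne h])
  sum := by
    refine Prod.ext ?_ (LinearMap.ext fun y => ?_)
    · rw [Prod.fst_sum]
      exact hP.sum
    · rw [Prod.snd_sum, LinearMap.sum_apply]
      exact Finset.univ_sum_single y
  mem_left u v := Prod.ext (hP.mem_left u v) (LinearMap.ext fun y => by
    simp [totalIdem, totalArrow])
  mem_right u v := Prod.ext (hP.mem_right u v) (LinearMap.ext fun y => by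
    simp [totalIdem, totalArrow])

theorem PathProd.fst {X : TRep k ι} {u v : ι} {y : A × Module.End k (∀ v, X.obj v)}
    (hy : PathProd r (fun v => (e v, totalIdem X v)) (fun u v => (x u v, totalArrow X u v)) u v y) :
    PathProd r e x u v y.1 := by
  induction hy with
  | nil => exact .nil u
  | cons hy h ih => exact ih.cons h

variable [Algebra k A] [Fintype ι]

theorem exists_action (hP : PathFamily e x) (hd : TreeDist adj d)
    (hsymm : ∀ u v, adj u v → adj v u) (hr : r = arr adj ξ)
    (hgen : Algebra.adjoin k (Set.range e ∪ {a | ∃ u v, r u v ∧ x u v = a}) = ⊤)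
    (hne : ∀ u v y, PathProd r e x u v y → y ≠ 0) (X : TRep k ι) :
    ∃ ρ : A →ₐ[k] Module.End k (∀ v, X.obj v), (∀ v, ρ (e v) = totalIdem X v) ∧
      ∀ u v, r u v → ρ (x u v) = totalArrow X u v := by
  let S : Set (A × Module.End k (∀ v, X.obj v)) := Set.range (fun v => (e v, totalIdem X v)) ∪
    {a | ∃ u v, r u v ∧ (x u v, totalArrow X u v) = a}
  let B := Algebra.adjoin k S
  let π : B →ₐ[k] A := (AlgHom.fst k A _).comp B.val
  have hinj : Function.Injective π := by
    intro a b hab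
    refine Subtype.ext (sub_eq_zero.1 ?_)
    exact (pathFamily_total hP X).eq_zero_of_map hd hsymm hr (AlgHom.fst k A _)
      (fun u v y hy => hne u v _ hy.fst) (sub_mem a.2 b.2)
      ((map_sub (AlgHom.fst k A _) a.1 b.1).trans (sub_eq_zero.2 hab))
  have hsurj : Function.Surjective π := by
    rw [← AlgHom.range_eq_top, eq_top_iff, ← hgen, Algebra.adjoin_le_iff]
    rintro a (⟨v, rfl⟩ | ⟨u, v, huv, rfl⟩)
    · exact ⟨⟨_, Algebra.subset_adjoin (Or.inl ⟨v, rfl⟩)⟩, rfl⟩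
    · exact ⟨⟨_, Algebra.subset_adjoin (Or.inr ⟨u, v, huv, rfl⟩)⟩, rfl⟩
  let φ := AlgEquiv.ofBijective π ⟨hinj, hsurj⟩
  have hφ : ∀ b : B, φ.symm b.1.1 = b := fun b => φ.symm_apply_apply b
  refine ⟨((AlgHom.snd k A _).comp B.val).comp φ.symm.toAlgHom, fun v => ?_, fun u v huv => ?_⟩
  · have := hφ ⟨_, Algebra.subset_adjoin (Or.inl ⟨v, rfl⟩)⟩
    exact congrArg (fun b : B => b.1.2) this
  · have := hφ ⟨_, Algebra.subset_adjoin (Or.inr ⟨u, v, huv, rfl⟩)⟩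
    exact congrArg (fun b : B => b.1.2) this

open scoped ModuleCat

theorem exists_module [FiniteDimensional k A] (hP : PathFamily e x) (hd : TreeDist adj d)
    (hsymm : ∀ u v, adj u v → adj v u) (hr : r = arr adj ξ)
    (hgen : Algebra.adjoin k (Set.range e ∪ {a | ∃ u v, r u v ∧ x u v = a}) = ⊤)
    (hne : ∀ u v y, PathProd r e x u v y → y ≠ 0) (X : TRep k ι) :
    ∃ (M : ModuleCat.{0} A) (_ : Module.Finite A M) (θ : (toRep k hP M).Fam X),
      IsHom r _ _ θ ∧ FamBij θ := by
  obtain ⟨ρ, hρe, hρx⟩ := exists_action hP hd hsymm hr hgen hne X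
  obtain ⟨M, hM, ψ, hψ⟩ : ∃ (M : ModuleCat.{0} A) (_ : Module.Finite A M)
      (ψ : M ≃+ (∀ v, X.obj v)), ∀ a y, ψ (a • y) = ρ a (ψ y) := by
    let : Module A (∀ v, X.obj v) := Module.compHom _ ρ.toRingHom
    have hsmul : ∀ (a : A) (y : ∀ v, X.obj v), a • y = ρ a y := fun a y => rfl
    have : IsScalarTower k A (∀ v, X.obj v) := ⟨fun c a y => by
      rw [hsmul, hsmul, map_smul]
      rfl⟩
    exact ⟨ModuleCat.of A (∀ v, X.obj v), Module.Finite.of_restrictScalars_finite k A _,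
      AddEquiv.refl _, hsmul⟩
  have hk : ∀ (c : k) (y : M), ψ (c • y) = c • ψ y := fun c y => by
    rw [← algebraMap_smul A c y, hψ, AlgHom.commutes]
    rfl
  let θ : (toRep k hP M).Fam X := fun v =>
    { toFun := fun y => ψ (elt hP y) v
      map_add' := fun y z => by simp
      map_smul' := fun c y => by simp [hk] }
  have hθ : ∀ v y, θ v y = ψ (elt hP y) v := fun v y => rfl
  refine ⟨M, hM, θ, fun u v huv y => ?_, fun v => ⟨fun y z hyz => ?_, fun y => ?_⟩⟩
  · rw [hθ, hθ, elt_map, hψ, hρx u v huv]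
    simp [totalArrow]
  · refine elt_injective (ψ.injective ?_)
    rw [← idem_smul_elt, ← idem_smul_elt hP z, hψ, hψ, hρe]
    exact congrArg (LinearMap.single k X.obj v) hyz
  · refine ⟨comp hP M v (ψ.symm (Pi.single v y)), ?_⟩
    rw [hθ, elt_comp, hψ, hρe]
    simp [totalIdem]

end FromRep

section Radical

open scoped ModuleCat

variable {k A : Type} [Field k] [Ring A] [Algebra k A] [FiniteDimensional k A]

/-- A nonzero composite remains nonzero after inserting an indecomposable direct summand. -/
theorem exists_indec_factor (k : Type) [Field k] [Algebra k A] [FiniteDimensional k A] (n : ℕ) :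
    ∀ X : ModuleCat.{0} A, Module.Finite A X →
      Module.finrank k X = n → ∀ (L Y : ModuleCat.{0} A) (g : L ⟶ X) (h : X ⟶ Y), g ≫ h ≠ 0 →
      ∃ (M : ModuleCat.{0} A) (_ : FinIndec A M) (p : X ⟶ M) (i : M ⟶ X),
        g ≫ p ≫ i ≫ h ≠ 0 := by
  induction n using Nat.strong_induction_on with
  | _ n ih =>
    intro X hX hn L Y g h hgh
    by_cases hI : Indec A X
    · exact ⟨X, ⟨hX, hI⟩, 𝟙 X, 𝟙 X, by simpa using hgh⟩
    have hnt : Nontrivial X := by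
      by_contra hnt
      rw [not_nontrivial_iff_subsingleton] at hnt
      refine hgh ?_
      ext y
      have : g.hom y = 0 := Subsingleton.elim _ _
      simp [this]
    obtain ⟨f, hff, hf0, hf1⟩ : ∃ f : X ⟶ X, f ≫ f = f ∧ f ≠ 0 ∧ f ≠ 𝟙 X := by
      by_contra! hall
      exact hI ⟨hnt, fun f hf => or_iff_not_imp_left.2 fun h0 => hall f hf h0⟩
    obtain ⟨q, hqq, hq1, hq⟩ : ∃ q : X ⟶ X, q ≫ q = q ∧ q ≠ 𝟙 X ∧ g ≫ q ≫ h ≠ 0 := by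
      by_contra! hall
      have h1 := hall f hff hf1
      have h2 := hall (𝟙 X - f) (by simp [hff]) (by simpa using hf0)
      refine hgh ?_
      rw [Preadditive.sub_comp, Preadditive.comp_sub, h1, Category.id_comp, sub_zero] at h2
      exact h2
    let N : ModuleCat.{0} A := ModuleCat.of A (LinearMap.range q.hom)
    have hN : Module.Finite A N := Module.Finite.range q.hom
    let π : X ⟶ N := ModuleCat.ofHom q.hom.rangeRestrict
    let j : N ⟶ X := ModuleCat.ofHom (LinearMap.range q.hom).subtype
    have hπj : π ≫ j = q := rfl
    have hlt : Module.finrank k N < n := by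
      have := finite_of_finite_module (k := k) X
      rw [← hn]
      have hle : LinearMap.range (q.hom.restrictScalars k) < ⊤ := by
        rw [lt_top_iff_ne_top]
        intro htop
        refine hq1 ?_
        ext y
        obtain ⟨z, rfl⟩ := LinearMap.range_eq_top.1 htop y
        exact congrArg (fun t : X ⟶ X => t.hom z) hqq
      exact Submodule.finrank_lt hle.ne
    obtain ⟨M, hM, p, i, hpi⟩ := ih _ hlt N hN rfl L Y (g ≫ π) (j ≫ h) (by
      rw [Category.assoc, ← Category.assoc π, hπj]
      exact hq)
    exact ⟨M, hM, π ≫ p, i ≫ j, by simpa using hpi⟩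

theorem mem_radSet_of_not_isIso {M N : ModuleCat.{0} A} (hM : Indec A M) (hN : Indec A N)
    {g : M ⟶ N} (hg : ¬ IsIso g) : g ∈ radSet A M N := by
  intro L hL h h' hiso
  have hL0 : 𝟙 L ≠ 0 := by
    have := hL.2.1
    obtain ⟨y, hy⟩ := exists_ne (0 : L)
    exact fun h0 => hy (congrArg (fun t : L ⟶ L => t.hom y) h0)
  let s := inv (h ≫ g ≫ h')
  have h1 : h ≫ g ≫ h' ≫ s = 𝟙 L := by
    have := IsIso.hom_inv_id (h ≫ g ≫ h')
    rwa [Category.assoc, Category.assoc] at this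
  have h1' : ∀ {Z : ModuleCat.{0} A} (t : L ⟶ Z), h ≫ g ≫ h' ≫ s ≫ t = t := fun t => by
    have := congrArg (· ≫ t) h1
    simpa using this
  have hM1 : g ≫ h' ≫ s ≫ h = 𝟙 M := by
    refine (hM.2 (g ≫ h' ≫ s ≫ h) (by simp [h1'])).resolve_left fun h0 => hL0 ?_
    have h2 : h ≫ (g ≫ h' ≫ s ≫ h) ≫ g ≫ h' ≫ s = 𝟙 L := by
      simp only [Category.assoc, h1', h1]
    rw [← h2, h0, Limits.zero_comp, Limits.comp_zero]
  have hN1 : h' ≫ s ≫ h ≫ g = 𝟙 N := by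
    refine (hN.2 (h' ≫ s ≫ h ≫ g) (by simp [h1'])).resolve_left fun h0 => hL0 ?_
    have h2 : h ≫ g ≫ (h' ≫ s ≫ h ≫ g) ≫ h' ≫ s = 𝟙 L := by
      simp only [Category.assoc, h1', h1]
    rw [← h2, h0, Limits.zero_comp, Limits.comp_zero, Limits.comp_zero]
  exact hg ⟨h' ≫ s ≫ h, hM1, by simpa using hN1⟩

theorem not_isIso_of_mem_radSet {M N X Y : ModuleCat.{0} A} (hM : FinIndec A M) {g : X ⟶ Y}
    (hg : g ∈ radSet A X Y) (t : M ⟶ X) (p : Y ⟶ N) : ¬ IsIso (t ≫ g ≫ p) := by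
  intro hiso
  refine hg M hM t (p ≫ inv (t ≫ g ≫ p)) ?_
  have : t ≫ g ≫ p ≫ inv (t ≫ g ≫ p) = 𝟙 M := by
    have := IsIso.hom_inv_id (t ≫ g ≫ p)
    rwa [Category.assoc, Category.assoc] at this
  rw [this]
  infer_instance

theorem radPowSet_antitone {n l : ℕ} (h : l ≤ n) (X Y : ModuleCat.{0} A) :
    radPowSet A n X Y ⊆ radPowSet A l X Y := by
  induction l generalizing n X with
  | zero => exact fun f _ => trivial
  | succ l ih =>
    obtain ⟨n, rfl⟩ : ∃ n', n = n' + 1 := ⟨n - 1, by omega⟩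
    rintro f ⟨M, g, h', hM, hg, hh, rfl⟩
    exact ⟨M, g, h', hM, hg, ih (by omega) M hh, rfl⟩

variable {ι : Type} [Fintype ι] {e : ι → A} {x : ι → ι → A} {r : ι → ι → Prop}

theorem exists_chain_of_radPowSet (hP : PathFamily e x)
    (hgen : Algebra.adjoin k (Set.range e ∪ {a | ∃ u v, r u v ∧ x u v = a}) = ⊤) (n : ℕ) :
    ∀ (L M X Y : ModuleCat.{0} A) [Module.Finite A M] [Module.Finite A X] (_ : Indec A M)
      (a : L ⟶ M) (t : M ⟶ X) (f : X ⟶ Y), f ∈ radPowSet A n X Y → a ≫ t ≫ f ≠ 0 →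
      ∃ (N : ModuleCat.{0} A) (_ : Module.Finite A N) (c : M ⟶ N), a ≫ c ≠ 0 ∧
        NChain r (IndecRep r) n (toRep k hP M) (toRep k hP N) (toRepMap hP c) := by
  induction n with
  | zero =>
    intro L M X Y _ _ hM a t f _ h0
    refine ⟨M, inferInstance, 𝟙 M, fun h => h0 ?_, ?_⟩
    · rw [Category.comp_id] at h
      rw [h, Limits.zero_comp]
    · rw [toRepMap_id]
      exact .nil _ ((indec_iff_indecRep hP hgen M).1 hM)
  | succ n ih =>
    rintro L M X Y hMf _ hM a t f ⟨X', g, f', hX', hg, hf', rfl⟩ h0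
    obtain ⟨M', ⟨hM'f, hM'⟩, p, i, hpi⟩ := exists_indec_factor k _ X' hX' rfl L Y (a ≫ t ≫ g) f'
      (by simpa using h0)
    obtain ⟨N, hN, c, hc, hch⟩ := ih L M' X' Y hM' (a ≫ t ≫ g ≫ p) i f' hf' (by simpa using hpi)
    refine ⟨N, hN, (t ≫ g ≫ p) ≫ c, by simpa using hc, ?_⟩
    rw [toRepMap_comp]
    refine .cons ((indec_iff_indecRep hP hgen M).1 hM) (isHom_toRepMap hP r _) ?_ hch
    rw [← isIso_iff_famBij hP hgen]
    exact not_isIso_of_mem_radSet ⟨hMf, hM⟩ hg t p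

theorem radVanishes_of_chain_le (hP : PathFamily e x)
    (hgen : Algebra.adjoin k (Set.range e ∪ {a | ∃ u v, r u v ∧ x u v = a}) = ⊤) {n : ℕ}
    (hn : ∀ (M N : TRep k ι) (c : M.Fam N), NChain r (IndecRep r) n M N c → c = 0) :
    RadVanishes A n := by
  intro X Y hX hY f hf
  by_contra h0
  obtain ⟨M, ⟨hMf, hM⟩, p, i, hpi⟩ := exists_indec_factor k _ X hX rfl X Y (𝟙 X) f (by simpa using h0)
  obtain ⟨N, hN, c, hc, hch⟩ := exists_chain_of_radPowSet (k := k) hP hgen n M M X Y hM (𝟙 M) i f hf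
    (by
      rw [Category.id_comp]
      intro h
      simp [h] at hpi)
  refine hc ?_
  rw [Category.id_comp]
  exact toRepMap_injective (k := k) hP ((hn _ _ _ hch).trans (toRepMap_zero hP M N).symm)

theorem IndecRep.of_famBij {M N : TRep k ι} {θ : M.Fam N} (hθ : IsHom r M N θ) (hb : FamBij θ)
    (hN : IndecRep r N) : IndecRep r M := by
  obtain ⟨θ', hθ', h1, h2⟩ := hb.exists_inverse hθ
  refine ⟨?_, fun f hf hff => ?_⟩
  · obtain ⟨v, y, hy⟩ := hN.1
    obtain ⟨z, rfl⟩ := (hb v).2 y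
    exact ⟨v, z, fun h => hy (h ▸ map_zero _)⟩
  · have key : ∀ g : M.Fam M, θ'.comp ((θ.comp (g.comp θ')).comp θ) = g := fun g => by
      show (θ'.comp θ).comp (g.comp (θ'.comp θ)) = g
      rw [h1]
      rfl
    have hidem : (θ.comp (f.comp θ')).comp (θ.comp (f.comp θ')) = θ.comp (f.comp θ') := by
      show θ.comp ((f.comp ((θ'.comp θ).comp f)).comp θ') = _
      rw [h1]
      show θ.comp ((f.comp f).comp θ') = _
      rw [hff]
    rcases hN.2 _ (hθ.comp (hf.comp hθ')) hidem with h0 | h0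
    · left
      rw [← key f, h0]
      funext v
      ext y
      simp
    · right
      rw [← key f, h0]
      exact h1

theorem exists_mem_radPowSet (hP : PathFamily e x)
    (hgen : Algebra.adjoin k (Set.range e ∪ {a | ∃ u v, r u v ∧ x u v = a}) = ⊤)
    (hess : ∀ X : TRep k ι, ∃ (M : ModuleCat.{0} A) (_ : Module.Finite A M)
      (θ : (toRep k hP M).Fam X), IsHom r _ _ θ ∧ FamBij θ)
    {n : ℕ} {M N : TRep k ι} {c : M.Fam N} (hc : NChain r (IndecRep r) n M N c) :
    ∀ (M' : ModuleCat.{0} A) [Module.Finite A M'] (θ : (toRep k hP M').Fam M),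
      IsHom r _ _ θ → FamBij θ → ∃ (N' : ModuleCat.{0} A) (_ : Module.Finite A N')
        (η : (toRep k hP N').Fam N) (f : M' ⟶ N'), f ∈ radPowSet A n M' N' ∧
        η.comp (toRepMap hP f) = c.comp θ := by
  induction hc with
  | nil M hM =>
    intro M' _ θ hθ hb
    exact ⟨M', inferInstance, θ, 𝟙 M', trivial, rfl⟩
  | @cons n M N X f g hM hf hfb hg ih =>
    intro M' _ θ hθ hθb
    obtain ⟨N', hN', η, hη, hηb⟩ := hess N
    obtain ⟨η', hη', h1, h2⟩ := hηb.exists_inverse hη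
    obtain ⟨t, ht⟩ := toRepMap_surjective hP hgen (hη'.comp (hf.comp hθ))
    obtain ⟨X', hX', κ, s, hs, hκ⟩ := ih N' η hη hηb
    refine ⟨X', hX', κ, t ≫ s, ⟨N', t, s, hN', ?_, hs, rfl⟩, ?_⟩
    · refine mem_radSet_of_not_isIso ((indec_iff_indecRep hP hgen M').2 (hM.of_famBij hθ hθb))
        ((indec_iff_indecRep hP hgen N').2 (hg.source.of_famBij hη hηb)) fun hiso => hfb fun v => ?_
      have hv := ((hηb v).comp ((isIso_iff_famBij hP hgen t).1 hiso v))
      rw [ht] at hv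
      have hcomp : η.comp (η'.comp (f.comp θ)) = f.comp θ := by
        show (η.comp η').comp (f.comp θ) = _
        rw [h2]
        rfl
      refine (Function.Bijective.of_comp_iff _ (hθb v)).1 ?_
      have hv' : Function.Bijective (η.comp (η'.comp (f.comp θ)) v) := hv
      rw [hcomp] at hv'
      exact hv'
    · show (κ.comp (toRepMap hP s)).comp (toRepMap hP t) = _
      rw [hκ, ht]
      show g.comp ((η.comp η').comp (f.comp θ)) = _
      rw [h2]
      rfl

/-- The nilpotency index of the radical in terms of chains of representations. -/
theorem nilpotencyIndex_of_chains (hP : PathFamily e x)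
    (hgen : Algebra.adjoin k (Set.range e ∪ {a | ∃ u v, r u v ∧ x u v = a}) = ⊤)
    (hess : ∀ X : TRep k ι, ∃ (M : ModuleCat.{0} A) (_ : Module.Finite A M)
      (θ : (toRep k hP M).Fam X), IsHom r _ _ θ ∧ FamBij θ) {n : ℕ}
    (hle : ∀ (M N : TRep k ι) (c : M.Fam N), NChain r (IndecRep r) (n + 1) M N c → c = 0)
    (hex : ∃ (M N : TRep k ι) (c : M.Fam N), NChain r (IndecRep r) n M N c ∧ c ≠ 0) :
    NilpotencyIndex A (n + 1) := by
  refine ⟨by omega, radVanishes_of_chain_le hP hgen hle, fun l hl => ?_⟩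
  by_contra hlt
  obtain ⟨M, N, c, hc, hc0⟩ := hex
  obtain ⟨M', hM', θ, hθ, hθb⟩ := hess M
  obtain ⟨N', hN', η, f, hf, hηf⟩ := exists_mem_radPowSet hP hgen hess hc M' θ hθ hθb
  obtain rfl := hl M' N' hM' hN' f (radPowSet_antitone (by omega) M' N' hf)
  refine hc0 ?_
  funext v
  ext y
  obtain ⟨z, rfl⟩ := (hθb v).2 y
  have := LinearMap.congr_fun (congrFun hηf v) z
  rw [toRepMap_zero] at this
  simpa using this.symm

end Radical

section Hereditary

variable {A : Type} [Ring A]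

/-- In a hereditary ring, nonzero elements compose to nonzero elements at a primitive idempotent. -/
theorem mul_ne_zero_of_hereditary (hher : Hereditary A) {ε a y : A} (hε : ε * ε = ε)
    (hprim : ∀ f g : A, f * f = f → g * g = g → f * g = 0 → g * f = 0 → f + g = ε →
      f = 0 ∨ g = 0) (ha : a * ε = a) (ha0 : a ≠ 0) (hy : ε * y = y) (hy0 : y ≠ 0) :
    a * y ≠ 0 := by
  intro hay
  let I : Submodule A A := Submodule.span A {y}
  have hyI : y ∈ I := Submodule.mem_span_singleton_self y
  have := hher I
  let φ : A →ₗ[A] I := LinearMap.toSpanSingleton A I ⟨y, hyI⟩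
  have hφ : Function.Surjective φ := fun ⟨z, hz⟩ => by
    obtain ⟨c, rfl⟩ := Submodule.mem_span_singleton.1 hz
    exact ⟨c, rfl⟩
  obtain ⟨s, hs⟩ := Module.projective_lifting_property φ LinearMap.id hφ
  let w : A := s ⟨y, hyI⟩
  have hwy : w * y = y := congrArg Subtype.val (LinearMap.congr_fun hs ⟨y, hyI⟩)
  have hsw : ∀ c z, c * y = z → ∀ hz : z ∈ I, s ⟨z, hz⟩ = c * w := by
    rintro c z rfl hz
    exact s.map_smul c ⟨y, hyI⟩
  have hw : ε * w = w := (hsw ε y hy hyI).symm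
  have hww : w * w = w := (hsw w y hwy hyI).symm
  have haw : a * w = 0 := (hsw a 0 hay I.zero_mem).symm.trans s.map_zero
  have hf : w * ε * (w * ε) = w * ε := by
    rw [mul_assoc, ← mul_assoc ε, hw, ← mul_assoc, hww]
  have hεf : ε * (w * ε) = w * ε := by rw [← mul_assoc, hw]
  have hfε : w * ε * ε = w * ε := by rw [mul_assoc, hε]
  rcases hprim (w * ε) (ε - w * ε) hf (by simp only [mul_sub, sub_mul, hf, hεf, hfε, hε]; abel)
    (by simp only [mul_sub, hf, hfε, sub_self]) (by simp only [sub_mul, hf, hεf, sub_self])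
    (by abel) with h | h
  · refine hy0 ?_
    rw [← hwy, ← hy, ← mul_assoc, h, zero_mul]
  · refine ha0 ?_
    rw [← ha, sub_eq_zero.1 h, ← mul_assoc, haw, zero_mul]

theorem pathProd_ne_zero (hher : Hereditary A) {ι : Type} [Fintype ι] {r : ι → ι → Prop}
    {e : ι → A} {x : ι → ι → A} (hP : PathFamily e x) (he : ∀ v, e v ≠ 0)
    (hprim : ∀ v (f g : A), f * f = f → g * g = g → f * g = 0 → g * f = 0 → f + g = e v →
      f = 0 ∨ g = 0) (hx : ∀ u v, r u v → x u v ≠ 0) {u v : ι} {y : A}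
    (hy : PathProd r e x u v y) : y ≠ 0 := by
  induction hy with
  | nil => exact he u
  | @cons v w y hy h ih =>
    exact mul_ne_zero_of_hereditary hher (hP.idem v) (hprim v) (hP.mem_right v w) (hx v w h)
      (hP.idem_mul_pathProd hy) ih

end Hereditary

section TypeE

/-- The distance between vertices of the graph `E_m`. -/
def eDist (m : ℕ) (u v : Fin m) : ℕ :=
  if (u : ℕ) + 1 = m then if (v : ℕ) + 1 = m then 0 else (v - 2 : ℕ) + (2 - v) + 1
  else if (v : ℕ) + 1 = m then (u - 2 : ℕ) + (2 - u) + 1 else (u - v : ℕ) + (v - u)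

theorem treeDist_eDist {m : ℕ} (hm : 6 ≤ m) : TreeDist (eAdj m) (eDist m) where
  self u := by
    unfold eDist
    split_ifs <;> omega
  step u a v h := by
    unfold eAdj at h
    unfold eDist
    split_ifs <;> omega
  unique u a b v ha hb h1 h2 := by
    unfold eAdj at ha hb
    unfold eDist at h1 h2
    apply Fin.ext
    split_ifs at h1 h2 <;> omega

/-- Every orientation of the graph `E_m` is given by a height function. -/
theorem exists_height {m : ℕ} (hm : 6 ≤ m) {r : Fin m → Fin m → Prop}
    (hr : ∀ u v, r u v → eAdj m u v) (htot : ∀ u v, eAdj m u v → r u v ∨ r v u)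
    (hasymm : ∀ u v, r u v → ¬ r v u) :
    ∃ ξ : Fin m → ℤ, IsSlice (eAdj m) ξ ∧ r = arr (eAdj m) ξ := by
  let o : ℕ → ℕ → ℤ := fun i j => if ∃ u v : Fin m, (u : ℕ) = i ∧ (v : ℕ) = j ∧ r u v then -1 else 1
  have ho : ∀ u v, r u v → o u v = -1 := fun u v h => if_pos ⟨u, v, rfl, rfl, h⟩
  have ho' : ∀ u v, r u v → o v u = 1 := fun u v h => if_neg fun ⟨a, b, ha, hb, h'⟩ => by
    obtain rfl := Fin.ext ha
    obtain rfl := Fin.ext hb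
    exact hasymm _ _ h h'
  let ζ : ℕ → ℤ := fun n => ∑ i ∈ Finset.range n, o i (i + 1)
  have hζ : ∀ n, ζ (n + 1) = ζ n + o n (n + 1) := fun n => Finset.sum_range_succ _ _
  let ξ : Fin m → ℤ := fun j => if (j : ℕ) + 1 = m then ζ 2 + o 2 j else ζ j
  have key : ∀ u v, r u v → ξ u = ξ v + 1 := fun u v h => by
    have h1 := ho u v h
    have h2 := ho' u v h
    rcases hr u v h with ⟨h3, h4⟩ | ⟨h3, h4⟩ | ⟨h3, h4⟩ | ⟨h3, h4⟩
    · have h5 : (u : ℕ) + 1 ≠ m := by omega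
      have h6 : (v : ℕ) + 1 ≠ m := by omega
      simp only [ξ, if_neg h5, if_neg h6]
      rw [← h4] at h1 ⊢
      rw [hζ, h1]
      ring
    · have h5 : (u : ℕ) + 1 ≠ m := by omega
      have h6 : (v : ℕ) + 1 ≠ m := by omega
      simp only [ξ, if_neg h5, if_neg h6]
      rw [← h4] at h2 ⊢
      rw [hζ, h2]
    · have h5 : (u : ℕ) + 1 ≠ m := by omega
      simp only [ξ, if_neg h5, if_pos h4]
      rw [h3] at h1 ⊢
      rw [h1]
      ring
    · have h6 : (v : ℕ) + 1 ≠ m := by omega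
      simp only [ξ, if_neg h6, if_pos h4]
      rw [h3] at h2 ⊢
      rw [h2]
  refine ⟨ξ, fun u v h => (htot u v h).imp (key u v) (key v u), ?_⟩
  funext u v
  refine propext ⟨fun h => ⟨hr u v h, ?_⟩, fun h => ?_⟩
  · rw [key u v h]
    omega
  · rcases htot u v h.1 with h' | h'
    · exact h'
    · have h1 := h.2
      rw [key v u h'] at h1
      omega

variable {k A V E : Type} [Field k] [Ring A] [Algebra k A] [Fintype V] [Fintype E]

/-- The combinatorial content of a quiver presentation with underlying graph `E_m`. -/
theorem exists_labelling {m : ℕ} (hm : 6 ≤ m) (P : QuiverPresentation k A V E)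
    (hgraph : P.GraphSpec m (m - 1) (typeEEnds m)) :
    ∃ v : Fin m ≃ V,
      (∀ α u w, P.src α = v u → P.tgt α = v w → eAdj m u w) ∧
      (∀ u w, eAdj m u w → (∃ α, P.src α = v u ∧ P.tgt α = v w) ∨
        ∃ α, P.src α = v w ∧ P.tgt α = v u) ∧
      ∀ α β, (P.src α = P.src β ∧ P.tgt α = P.tgt β) ∨ (P.src α = P.tgt β ∧ P.tgt α = P.src β) →
        α = β := by
  obtain ⟨v, ar, har⟩ := hgraph
  have hends : ∀ (i : Fin (m - 1)), ((i : ℕ) = m - 2 ∧ typeEEnds m i = (2, m - 1)) ∨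
      ((i : ℕ) ≠ m - 2 ∧ typeEEnds m i = ((i : ℕ), (i : ℕ) + 1)) := fun i => by
    unfold typeEEnds
    split_ifs with h
    · exact Or.inl ⟨h, rfl⟩
    · exact Or.inr ⟨h, rfl⟩
  refine ⟨v, fun α u w hu hw => ?_, fun u w h => ?_, fun α β h => ?_⟩
  · obtain ⟨i, rfl⟩ := ar.surjective α
    obtain ⟨a, b, ha, hb, hab⟩ := har i
    rw [hu, hw] at hab
    simp only [v.injective.eq_iff] at hab
    have hi := i.2
    unfold eAdj
    rcases hends i with ⟨h1, h2⟩ | ⟨h1, h2⟩ <;> rw [h2] at ha hb <;> simp only at ha hb <;>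
      rcases hab with ⟨rfl, rfl⟩ | ⟨rfl, rfl⟩ <;> omega
  · have main : ∀ (i : Fin (m - 1)) (p q : Fin m), typeEEnds m i = ((p : ℕ), (q : ℕ)) →
        (∃ α, P.src α = v p ∧ P.tgt α = v q) ∨ ∃ α, P.src α = v q ∧ P.tgt α = v p := by
      intro i p q hpq
      obtain ⟨a, b, ha, hb, hab⟩ := har i
      rw [hpq] at ha hb
      obtain rfl := Fin.ext ha
      obtain rfl := Fin.ext hb
      exact hab.imp (fun h => ⟨_, h⟩) fun h => ⟨_, h⟩
    have line : ∀ p q : Fin m, (q : ℕ) + 1 < m → (p : ℕ) + 1 = q →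
        (∃ α, P.src α = v p ∧ P.tgt α = v q) ∨ ∃ α, P.src α = v q ∧ P.tgt α = v p :=
      fun p q h1 h2 => main ⟨p, by omega⟩ p q <| by
        rcases hends ⟨p, by omega⟩ with ⟨h3, -⟩ | ⟨-, h4⟩
        · simp only at h3
          omega
        · rw [h4, h2]
    have branch : ∀ p q : Fin m, (p : ℕ) = 2 → (q : ℕ) + 1 = m →
        (∃ α, P.src α = v p ∧ P.tgt α = v q) ∨ ∃ α, P.src α = v q ∧ P.tgt α = v p :=
      fun p q h1 h2 => main ⟨m - 2, by omega⟩ p q <| by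
        rcases hends ⟨m - 2, by omega⟩ with ⟨-, h4⟩ | ⟨h3, -⟩
        · rw [h4, h1]
          exact congrArg _ (by omega)
        · exact absurd rfl h3
    rcases h with ⟨h1, h2⟩ | ⟨h1, h2⟩ | ⟨h1, h2⟩ | ⟨h1, h2⟩
    · exact line u w h1 h2
    · exact (line w u h1 h2).symm
    · exact branch u w h1 h2
    · exact (branch w u h1 h2).symm
  · obtain ⟨i, rfl⟩ := ar.surjective α
    obtain ⟨j, rfl⟩ := ar.surjective β
    obtain ⟨a, b, ha, hb, hab⟩ := har i
    obtain ⟨c, d, hc, hd, hcd⟩ := har j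
    have hab' : (a = c ∧ b = d) ∨ (a = d ∧ b = c) := by
      rcases hab with ⟨h1, h2⟩ | ⟨h1, h2⟩ <;> rcases hcd with ⟨h3, h4⟩ | ⟨h3, h4⟩ <;>
        rw [h1, h2, h3, h4] at h <;> simp only [v.injective.eq_iff] at h <;> tauto
    have hi := i.2
    have hj := j.2
    refine congrArg ar (Fin.ext ?_)
    rcases hends i with ⟨h1, h2⟩ | ⟨h1, h2⟩ <;> rcases hends j with ⟨h3, h4⟩ | ⟨h3, h4⟩ <;>
      rw [h2] at ha hb <;> rw [h4] at hc hd <;> simp only at ha hb hc hd <;>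
      rcases hab' with ⟨rfl, rfl⟩ | ⟨rfl, rfl⟩ <;> omega

theorem nilpotencyIndex_of_coxeterData [FiniteDimensional k A] (P : QuiverPresentation k A V E)
    (hher : Hereditary A) {m h : ℕ} (hm : 6 ≤ m) {star : Fin m → Fin m}
    (D : CoxeterData (eAdj m) h star) (hgraph : P.GraphSpec m (m - 1) (typeEEnds m)) :
    NilpotencyIndex A (h - 2 + 1) := by
  obtain ⟨v, hadj, htot, huniq⟩ := exists_labelling hm P hgraph
  let r : Fin m → Fin m → Prop := fun u w => ∃ α, P.src α = v u ∧ P.tgt α = v w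
  obtain ⟨ξ, hs, hr⟩ := exists_height (r := r) hm (fun u w ⟨α, h1, h2⟩ => hadj α u w h1 h2) htot
    (fun u w ⟨α, h1, h2⟩ ⟨β, h3, h4⟩ => by
      obtain rfl := huniq α β (Or.inr ⟨h1.trans h4.symm, h2.trans h3.symm⟩)
      obtain rfl := v.injective (h1.symm.trans h3)
      have := hadj α u u h1 h2
      unfold eAdj at this
      omega)
  let e : Fin m → A := fun u => P.idem (v u)
  let x : Fin m → Fin m → A := fun u w => if h : r u w then P.arrow h.choose else 0
  have hx : ∀ α u w, P.src α = v u → P.tgt α = v w → x u w = P.arrow α := fun α u w h1 h2 => by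
    have h : r u w := ⟨α, h1, h2⟩
    have h3 := h.choose_spec
    simp only [x, dif_pos h]
    exact congrArg P.arrow (huniq _ _ (Or.inl ⟨h3.1.trans h1.symm, h3.2.trans h2.symm⟩))
  have hx0 : ∀ u w, ¬ r u w → x u w = 0 := fun u w h => dif_neg h
  have hleft : ∀ α, P.idem (P.tgt α) * P.arrow α = P.arrow α := fun α => by
    rw [← P.arrow_mem α, mul_assoc (P.idem _), ← mul_assoc, P.idem_idem]
  have hright : ∀ α, P.arrow α * P.idem (P.src α) = P.arrow α := fun α => by
    rw [← P.arrow_mem α, mul_assoc, P.idem_idem]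
  have hP : PathFamily e x :=
    { idem := fun u => P.idem_idem _
      orth := fun u w h => P.idem_orth _ _ (v.injective.ne h)
      sum := (Equiv.sum_comp v P.idem).trans P.sum_idem
      mem_left := fun u w => by
        by_cases h : r u w
        · obtain ⟨α, h1, h2⟩ := h
          rw [hx α u w h1 h2]
          simpa only [e, ← h2] using hleft α
        · rw [hx0 u w h, mul_zero]
      mem_right := fun u w => by
        by_cases h : r u w
        · obtain ⟨α, h1, h2⟩ := h
          rw [hx α u w h1 h2]
          simpa only [e, ← h1] using hright α
        · rw [hx0 u w h, zero_mul] }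
  have hgen : Algebra.adjoin k (Set.range e ∪ {a | ∃ u w, r u w ∧ x u w = a}) = ⊤ := by
    rw [← P.generates]
    congr 2
    · exact v.surjective.range_comp P.idem
    · ext a
      constructor
      · rintro ⟨u, w, ⟨α, h1, h2⟩, rfl⟩
        exact ⟨α, (hx α u w h1 h2).symm⟩
      · rintro ⟨α, rfl⟩
        obtain ⟨u, hu⟩ := v.surjective (P.src α)
        obtain ⟨w, hw⟩ := v.surjective (P.tgt α)
        exact ⟨u, w, ⟨α, hu.symm, hw.symm⟩, hx α u w hu.symm hw.symm⟩
  have hne : ∀ u w y, PathProd r e x u w y → y ≠ 0 := fun u w y hy =>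
    pathProd_ne_zero hher hP (fun u => P.idem_ne _) (fun u => P.idem_primitive _)
      (fun u w ⟨α, h1, h2⟩ => by rw [hx α u w h1 h2]; exact P.arrow_ne α) hy
  have : Nonempty (Fin m) := ⟨⟨0, by omega⟩⟩
  obtain ⟨i, hi⟩ := Finite.exists_max ξ
  obtain ⟨j, hj⟩ := Finite.exists_min ξ
  have hess := exists_module hP (treeDist_eDist hm) D.symm hr hgen hne
  refine nilpotencyIndex_of_chains hP hgen hess (fun M N c hc => ?_) ?_
  · by_contra hc0
    rw [hr] at hc
    have := D.chain_le hs hi rfl hc hc0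
    omega
  · rw [hr]
    exact D.exists_chain hs hj

end TypeE

end DynkinRep

/-- Theorem (Zacharia): if `H = kQ` is a hereditary algebra whose underlying graph is
`E_6`, `E_7` or `E_8`, then the nilpotency index of the radical of `mod H` equals
`11`, `17` or `29` respectively. -/
theorem nilpotency_index_hereditary_typeE (k A : Type) [Field k] [IsAlgClosed k] [Ring A] [Algebra k A]
    [FiniteDimensional k A] (V E : Type) [Fintype V] [Fintype E]
    (P : QuiverPresentation k A V E) (hadm : P.Admissible) (hmin : P.Minimal)
    (hher : Hereditary A)
    (m : ℕ) (hm : m = 6 ∨ m = 7 ∨ m = 8)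
    (hgraph : P.GraphSpec m (m - 1) (typeEEnds m)) :
    NilpotencyIndex A (if m = 6 then 11 else if m = 7 then 17 else 29) := by
  rcases hm with rfl | rfl | rfl
  · exact DynkinRep.nilpotencyIndex_of_coxeterData P hher (by omega) DynkinRep.coxeterData_six hgraph
  · exact DynkinRep.nilpotencyIndex_of_coxeterData P hher (by omega) DynkinRep.coxeterData_seven hgraph
  · exact DynkinRep.nilpotencyIndex_of_coxeterData P hher (by omega) DynkinRep.coxeterData_eight hgraph
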